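/- (Pre-compactness criterion.) A subset 𝒞 ⊆ ℳ̂_* is relatively compact under the Gromov-Hausdorff-Prokhorov metric d if and only if for every r ≥ 0, the set of balls 𝒞_r := {B̄_r(𝒳) : 𝒳 ∈ 𝒞} is relatively compact in the set of compact pmm spaces under the metric dc. -/

import Mathlib

open MeasureTheory Topology Filter

noncomputable section

/-- Prokhorov distance between finite Borel measures on a metric space. -/
def prokhorovDist {Z : Type*} [MetricSpace Z] [MeasurableSpace Z]
    (μ ν : Measure Z) : ℝ :=
  sInf {ε : ℝ | 0 < ε ∧ ∀ A : Set Z, IsClosed A →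
    μ A ≤ ν (Metric.cthickening ε A) + ENNReal.ofReal ε ∧
    ν A ≤ μ (Metric.cthickening ε A) + ENNReal.ofReal ε}

/-- A pointed measured metric space: a metric space with a distinguished point and a Borel
measure. -/
structure PMM : Type 1 where
  carrier : Type
  metric : MetricSpace carrier
  basepoint : carrier
  meas : @Measure carrier
    (@borel carrier metric.toPseudoMetricSpace.toUniformSpace.toTopologicalSpace)

attribute [instance] PMM.metric

instance PMM.instMeasurableSpace (𝒳 : PMM) : MeasurableSpace 𝒳.carrier := borel 𝒳.carrier

instance PMM.instBorelSpace (𝒳 : PMM) : BorelSpace 𝒳.carrier := ⟨rfl⟩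

/-- A pmm space is boundedly compact if every closed ball is compact and has finite measure. -/
def PMM.BoundedlyCompact (𝒳 : PMM) : Prop :=
  (∀ (x : 𝒳.carrier) (r : ℝ), IsCompact (Metric.closedBall x r)) ∧
  (∀ (x : 𝒳.carrier) (r : ℝ), 𝒳.meas (Metric.closedBall x r) ≠ ⊤)

/-- A pmm space is compact if its carrier is compact and its measure is finite. -/
def PMM.IsCompactPMM (𝒳 : PMM) : Prop :=
  CompactSpace 𝒳.carrier ∧ 𝒳.meas Set.univ ≠ ⊤

/-- A pair of maps of two pmm spaces into a common metric space. -/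
structure GHPEmbedding (𝒳 𝒴 : PMM) : Type 1 where
  Z : Type
  mZ : MetricSpace Z
  f : 𝒳.carrier → Z
  g : 𝒴.carrier → Z

attribute [instance] GHPEmbedding.mZ

/-- Both maps of a `GHPEmbedding` are isometric embeddings. -/
def GHPEmbedding.IsIsometric {𝒳 𝒴 : PMM} (e : GHPEmbedding 𝒳 𝒴) : Prop :=
  Isometry e.f ∧ Isometry e.g

/-- The quantity `max(d(f o_X, g o_Y), dH(f(X), g(Y)), dP(f_*μ_X, g_*μ_Y))` associated to a
pair of embeddings into a common space. -/
def GHPEmbedding.value {𝒳 𝒴 : PMM} (e : GHPEmbedding 𝒳 𝒴) : ℝ :=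
  letI : MeasurableSpace e.Z := borel e.Z
  max (dist (e.f 𝒳.basepoint) (e.g 𝒴.basepoint))
    (max (Metric.hausdorffDist (Set.range e.f) (Set.range e.g))
      (prokhorovDist (𝒳.meas.map e.f) (𝒴.meas.map e.g)))

/-- The Gromov-Hausdorff-Prokhorov distance of compact pmm spaces. -/
def cGHP (𝒳 𝒴 : PMM) : ℝ :=
  sInf {x : ℝ | ∃ e : GHPEmbedding 𝒳 𝒴, e.IsIsometric ∧ x = e.value}

/-- A pmm-subspace of a pmm space `𝒳`: a subset containing the basepoint together with a
measure `≤ 𝒳.meas` supported on the subset. -/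
structure SubPMM (𝒳 : PMM) where
  set : Set 𝒳.carrier
  root_mem : 𝒳.basepoint ∈ set
  meas : Measure 𝒳.carrier
  meas_le : meas ≤ 𝒳.meas
  supported : meas setᶜ = 0

/-- The pmm space associated to a pmm-subspace. -/
def SubPMM.toPMM {𝒳 : PMM} (S : SubPMM 𝒳) : PMM where
  carrier := ↥S.set
  metric := inferInstance
  basepoint := ⟨𝒳.basepoint, S.root_mem⟩
  meas := @Measure.comap ↥S.set 𝒳.carrier (borel ↥S.set) inferInstance Subtype.val S.meas

/-- The pmm-subspace ordering: inclusion of sets and inequality of measures. -/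
instance {𝒳 : PMM} : LE (SubPMM 𝒳) :=
  ⟨fun S T => S.set ⊆ T.set ∧ S.meas ≤ T.meas⟩

/-- Compactness of a pmm-subspace. -/
def SubPMM.IsCompactSub {𝒳 : PMM} (S : SubPMM 𝒳) : Prop :=
  IsCompact S.set ∧ S.meas Set.univ ≠ ⊤

/-- The closed ball of radius `r` around the basepoint, as a pmm-subspace (for `r ≥ 0` the
underlying set is exactly the closed ball; the basepoint is inserted so that the definition
makes sense for all `r`). -/
def PMM.ballSub (𝒳 : PMM) (r : ℝ) : SubPMM 𝒳 where
  set := insert 𝒳.basepoint (Metric.closedBall 𝒳.basepoint r)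
  root_mem := Set.mem_insert _ _
  meas := 𝒳.meas.restrict (insert 𝒳.basepoint (Metric.closedBall 𝒳.basepoint r))
  meas_le := Measure.restrict_le_self
  supported := by
    rw [Measure.restrict_apply ((measurableSet_closedBall.insert 𝒳.basepoint).compl),
      Set.compl_inter_self]
    simp

/-- The quantity `a(ε, r; 𝒳, 𝒴)`. -/
def aFun (ε r : ℝ) (𝒳 𝒴 : PMM) : ℝ :=
  sInf {x : ℝ | ∃ Y' : SubPMM 𝒴, Y'.IsCompactSub ∧ 𝒴.ballSub (r - ε) ≤ Y' ∧
    x = cGHP ((𝒳.ballSub r).toPMM) Y'.toPMM}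

/-- The quantity `a_ε(𝒳, 𝒴) = a(ε, 1/ε; 𝒳, 𝒴)`. -/
def aEps (ε : ℝ) (𝒳 𝒴 : PMM) : ℝ := aFun ε (1 / ε) 𝒳 𝒴

/-- The Gromov-Hausdorff-Prokhorov distance of boundedly compact pmm spaces
(with `inf ∅ = 1`). -/
def GHP (𝒳 𝒴 : PMM) : ℝ :=
  sInf (insert 1 {ε : ℝ | ε ∈ Set.Ioc (0 : ℝ) 1 ∧ max (aEps ε 𝒳 𝒴) (aEps ε 𝒴 𝒳) < ε / 2})

/-- Two pmm spaces are GHP-isometric if there is a root-preserving measure-preserving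
surjective isometry between them. -/
def GHPIsometric (𝒳 𝒴 : PMM) : Prop :=
  ∃ ρ : 𝒳.carrier → 𝒴.carrier, Isometry ρ ∧ Function.Surjective ρ ∧
    ρ 𝒳.basepoint = 𝒴.basepoint ∧ 𝒳.meas.map ρ = 𝒴.meas

/-- `r` is a continuity radius of a pmm space. -/
def PMM.ContinuityRadius (𝒳 : PMM) (r : ℝ) : Prop :=
  0 < r ∧ Metric.closedBall 𝒳.basepoint r = closure (Metric.ball 𝒳.basepoint r) ∧
    𝒳.meas (Metric.closedBall 𝒳.basepoint r \ Metric.ball 𝒳.basepoint r) = 0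

set_option linter.unusedVariables false
set_option linter.style.haveILetI false

theorem SubPMM.toPMM_meas_preimage {𝒳 : PMM} (S : SubPMM 𝒳) (hS : MeasurableSet S.set)
    {C : Set 𝒳.carrier} (hC : MeasurableSet C) :
    S.toPMM.meas ((Subtype.val : S.set → 𝒳.carrier) ⁻¹' C) = S.meas C := by
  have key : ∀ (m : MeasurableSpace S.set), m = Subtype.instMeasurableSpace →
      (@Measure.comap ↥S.set 𝒳.carrier m inferInstance Subtype.val S.meas)
        ((Subtype.val : S.set → 𝒳.carrier) ⁻¹' C) = S.meas C := by
    intro m hm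
    subst hm
    rw [(MeasurableEmbedding.subtype_coe hS).comap_apply, Subtype.image_preimage_coe]
    refine le_antisymm (measure_mono Set.inter_subset_right) ?_
    calc S.meas C ≤ S.meas ((S.set ∩ C) ∪ S.setᶜ) := measure_mono (by
            intro x hx; by_cases h : x ∈ S.set
            · exact Or.inl ⟨h, hx⟩
            · exact Or.inr h)
      _ ≤ S.meas (S.set ∩ C) + S.meas S.setᶜ := measure_union_le _ _
      _ = S.meas (S.set ∩ C) := by rw [S.supported, add_zero]
  exact key _ (Subtype.borelSpace S.set).measurable_eq.symm

theorem SubPMM.toPMM_meas_univ {𝒳 : PMM} (S : SubPMM 𝒳) (hS : MeasurableSet S.set) :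
    S.toPMM.meas Set.univ = S.meas Set.univ :=
  S.toPMM_meas_preimage hS MeasurableSet.univ

theorem SubPMM.IsCompactSub.isCompactPMM {𝒳 : PMM} {S : SubPMM 𝒳} (h : S.IsCompactSub) :
    S.toPMM.IsCompactPMM := by
  refine ⟨isCompact_iff_compactSpace.1 h.1, ?_⟩
  rw [S.toPMM_meas_univ h.1.measurableSet]
  exact h.2

theorem prokhorovDist_nonneg {Z : Type*} [MetricSpace Z] [MeasurableSpace Z]
    (μ ν : Measure Z) : 0 ≤ prokhorovDist μ ν :=
  Real.sInf_nonneg fun _ hx => hx.1.le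

theorem GHPEmbedding.value_nonneg {𝒳 𝒴 : PMM} (e : GHPEmbedding 𝒳 𝒴) : 0 ≤ e.value :=
  le_max_of_le_left dist_nonneg

theorem cGHP_nonneg (𝒳 𝒴 : PMM) : 0 ≤ cGHP 𝒳 𝒴 := by
  refine Real.sInf_nonneg ?_
  rintro x ⟨e, -, rfl⟩
  exact e.value_nonneg

theorem cGHP_le {𝒳 𝒴 : PMM} (e : GHPEmbedding 𝒳 𝒴) (h : e.IsIsometric) : cGHP 𝒳 𝒴 ≤ e.value := by
  refine csInf_le ⟨0, ?_⟩ ⟨e, h, rfl⟩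
  rintro x ⟨e, -, rfl⟩
  exact e.value_nonneg

theorem exists_embedding_of_cGHP_lt {𝒳 𝒴 : PMM} {δ : ℝ} (h : cGHP 𝒳 𝒴 < δ) :
    ∃ e : GHPEmbedding 𝒳 𝒴, e.IsIsometric ∧ e.value < δ := by
  have hne : {x : ℝ | ∃ e : GHPEmbedding 𝒳 𝒴, e.IsIsometric ∧ x = e.value}.Nonempty := by
    refine ⟨_, ⟨𝒳.carrier × 𝒴.carrier, inferInstance, fun x => (x, 𝒴.basepoint),
      fun y => (𝒳.basepoint, y)⟩, ⟨?_, ?_⟩, rfl⟩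
    · exact Isometry.of_dist_eq fun x y => by simp [Prod.dist_eq]
    · exact Isometry.of_dist_eq fun x y => by simp [Prod.dist_eq]
  obtain ⟨x, ⟨e, he, rfl⟩, hx⟩ := exists_lt_of_csInf_lt hne h
  exact ⟨e, he, hx⟩

/-- A set is covered by `N` pieces of diameter at most `ε`. -/
def NetSmall {α : Type*} [MetricSpace α] (N : ℕ) (ε : ℝ) (s : Set α) : Prop :=
  ∃ p : α → Fin N, ∀ x ∈ s, ∀ y ∈ s, p x = p y → dist x y ≤ ε

theorem NetSmall.mono {α : Type*} [MetricSpace α] {N M : ℕ} {ε : ℝ} {s t : Set α}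
    (h : NetSmall N ε s) (hts : t ⊆ s) (hNM : N ≤ M) : NetSmall M ε t := by
  obtain ⟨p, hp⟩ := h
  refine ⟨fun x => Fin.castLE hNM (p x), fun x hx y hy hxy => hp x (hts hx) y (hts hy) ?_⟩
  simpa using hxy

theorem IsCompact.small {α : Type*} [MetricSpace α] {s : Set α} (hs : IsCompact s) {ε : ℝ}
    (hε : 0 < ε) : ∃ N, NetSmall N ε s := by
  classical
  obtain ⟨t, -, ht, hst⟩ := hs.finite_cover_balls (half_pos hε)
  have : Finite t := ht
  let e := (Finite.equivFin t)
  have hch : ∀ x : α, ∃ i : Fin (Nat.card t + 1), x ∈ s → ∃ y : t, i = (e y).castSucc ∧ dist x y < ε/2 := by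
    intro x
    by_cases hx : x ∈ s
    · have := hst hx
      simp only [Set.mem_iUnion, Metric.mem_ball] at this
      obtain ⟨y, hy, hxy⟩ := this
      exact ⟨(e ⟨y, hy⟩).castSucc, fun _ => ⟨⟨y, hy⟩, rfl, hxy⟩⟩
    · exact ⟨0, fun h => absurd h hx⟩
  choose p hp using hch
  refine ⟨_, p, fun x hx y hy hxy => ?_⟩
  obtain ⟨a, ha, hxa⟩ := hp x hx
  obtain ⟨b, hb, hyb⟩ := hp y hy
  have hab : a = b := by
    have : (e a).castSucc = (e b).castSucc := by rw [← ha, ← hb, hxy]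
    exact e.injective (Fin.castSucc_injective _ this)
  subst hab
  have := dist_triangle_right x y a
  linarith

/-- Transfer of covering numbers and masses along a small `cGHP` distance. -/
theorem small_of_cGHP_lt {A B : PMM} (hA : A.IsCompactPMM) (hB : B.IsCompactPMM) {δ : ℝ}
    (h : cGHP A B < δ) {r ε : ℝ} {N : ℕ}
    (hs : NetSmall N ε (Metric.closedBall B.basepoint (r + 2 * δ))) :
    NetSmall N (ε + 2 * δ) (Metric.closedBall A.basepoint r) ∧
    A.meas (Metric.closedBall A.basepoint r) ≤
      B.meas (Metric.closedBall B.basepoint (r + 2 * δ)) + ENNReal.ofReal δ := by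
  obtain ⟨e, ⟨hf, hg⟩, hv⟩ := exists_embedding_of_cGHP_lt h
  letI : MeasurableSpace e.Z := borel e.Z
  haveI : BorelSpace e.Z := ⟨rfl⟩
  have hv' : max (dist (e.f A.basepoint) (e.g B.basepoint))
    (max (Metric.hausdorffDist (Set.range e.f) (Set.range e.g))
      (prokhorovDist (A.meas.map e.f) (B.meas.map e.g))) < δ := hv
  rw [max_lt_iff, max_lt_iff] at hv'
  obtain ⟨h1, h2, h3⟩ := hv'
  haveI := hA.1
  haveI := hB.1
  have hfin : Metric.hausdorffEDist (Set.range e.f) (Set.range e.g) ≠ ⊤ := by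
    apply Metric.hausdorffEDist_ne_top_of_nonempty_of_bounded
    · exact ⟨_, Set.mem_range_self A.basepoint⟩
    · exact ⟨_, Set.mem_range_self B.basepoint⟩
    · exact (isCompact_range hf.continuous).isBounded
    · exact (isCompact_range hg.continuous).isBounded
  have hb : ∀ a : A.carrier, ∃ b : B.carrier, dist (e.f a) (e.g b) < δ := by
    intro a
    obtain ⟨_, ⟨b, rfl⟩, hab⟩ :=
      Metric.exists_dist_lt_of_hausdorffDist_lt (Set.mem_range_self a) h2 hfin
    exact ⟨b, hab⟩
  choose b hb using hb
  have hball : ∀ (a : A.carrier) (b : B.carrier) , dist a A.basepoint ≤ r →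
      dist (e.f a) (e.g b) ≤ δ → dist b B.basepoint ≤ r + 2 * δ := by
    intro a b ha hab
    rw [← hg.dist_eq]
    have e1 := dist_triangle4 (e.g b) (e.f a) (e.f A.basepoint) (e.g B.basepoint)
    rw [hf.dist_eq, dist_comm (e.g b) (e.f a)] at e1
    linarith
  constructor
  · obtain ⟨p, hp⟩ := hs
    refine ⟨fun a => p (b a), fun x hx y hy hxy => ?_⟩
    have h4 := hp (b x) (hball x (b x) hx (hb x).le) (b y) (hball y (b y) hy (hb y).le) hxy
    rw [← hg.dist_eq] at h4
    rw [← hf.dist_eq]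
    have e1 := dist_triangle4 (e.f x) (e.g (b x)) (e.g (b y)) (e.f y)
    have := hb x
    have := hb y
    rw [dist_comm (e.g (b y)) (e.f y)] at e1
    linarith
  · have hne : {ε : ℝ | 0 < ε ∧ ∀ C : Set e.Z, IsClosed C →
      A.meas.map e.f C ≤ B.meas.map e.g (Metric.cthickening ε C) + ENNReal.ofReal ε ∧
      B.meas.map e.g C ≤ A.meas.map e.f (Metric.cthickening ε C) + ENNReal.ofReal ε}.Nonempty := by
      refine ⟨(A.meas Set.univ).toReal + (B.meas Set.univ).toReal + 1, by positivity, ?_⟩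
      intro C hC
      rw [Measure.map_apply hf.continuous.measurable hC.measurableSet,
        Measure.map_apply hg.continuous.measurable hC.measurableSet]
      constructor
      · refine le_trans (measure_mono (Set.subset_univ _)) (le_trans ?_ le_add_self)
        refine (ENNReal.le_ofReal_iff_toReal_le hA.2 (by positivity)).2 (by
          have : 0 ≤ (B.meas Set.univ).toReal := ENNReal.toReal_nonneg
          linarith)
      · refine le_trans (measure_mono (Set.subset_univ _)) (le_trans ?_ le_add_self)
        refine (ENNReal.le_ofReal_iff_toReal_le hB.2 (by positivity)).2 (by
          have : 0 ≤ (A.meas Set.univ).toReal := ENNReal.toReal_nonneg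
          linarith)
    obtain ⟨η, ⟨hη0, hη⟩, hηδ⟩ := exists_lt_of_csInf_lt hne h3
    have hcpt : IsCompact (e.f '' Metric.closedBall A.basepoint r) :=
      (Metric.isClosed_closedBall.isCompact).image hf.continuous
    have hC := (hη (e.f '' Metric.closedBall A.basepoint r) hcpt.isClosed).1
    rw [Measure.map_apply hf.continuous.measurable hcpt.isClosed.measurableSet,
      Measure.map_apply hg.continuous.measurable Metric.isClosed_cthickening.measurableSet,
      Set.preimage_image_eq _ hf.injective] at hC
    refine hC.trans (add_le_add (measure_mono ?_) (ENNReal.ofReal_le_ofReal hηδ.le))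
    intro y hy
    rw [Set.mem_preimage, hcpt.cthickening_eq_biUnion_closedBall hη0.le] at hy
    simp only [Set.mem_iUnion] at hy
    obtain ⟨_, ⟨x, hx, rfl⟩, hxy⟩ := hy
    rw [Metric.mem_closedBall, dist_comm] at hxy
    exact hball x y hx (hxy.trans hηδ.le)


/-- One half of the Prokhorov estimate, in an arbitrary metric space. -/
theorem map_le_of_net {Z X Y : Type*} [MetricSpace Z] [MetricSpace X] [MetricSpace Y]
    [MeasurableSpace X] [BorelSpace X]
    (f : X → Z) (g : Y → Z) (hf : Isometry f) (hg : Isometry g)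
    {ι : Type*} (c : ι → X) (y : ι → Y) {ε : ℝ} (hε : 0 < ε)
    (hd : ∀ i, dist (f (c i)) (g (y i)) ≤ ε) (S : Set X) (μ : Measure X) (hμ : μ Sᶜ = 0)
    [MeasurableSpace Y] (ν : Measure Y)
    (hS : ∀ a ∈ S, ∃ i, dist a (c i) ≤ ε)
    (hm : ∀ I : Set ι, μ (⋃ i ∈ I, Metric.closedBall (c i) ε) ≤
      ν (⋃ i ∈ I, Metric.closedBall (y i) (3 * ε)) + ENNReal.ofReal ε) (C : Set Z) :
    μ (f ⁻¹' C) ≤ ν (g ⁻¹' (Metric.cthickening (5 * ε) C)) + ENNReal.ofReal (5 * ε) := by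
  let I : Set ι := {i | ∃ x, f x ∈ C ∧ dist x (c i) ≤ ε}
  calc μ (f ⁻¹' C) ≤ μ ((⋃ i ∈ I, Metric.closedBall (c i) ε) ∪ Sᶜ) := by
        refine measure_mono fun x hx => ?_
        by_cases hxS : x ∈ S
        · obtain ⟨i, hi⟩ := hS x hxS
          left
          simp only [Set.mem_iUnion]
          exact ⟨i, ⟨x, hx, hi⟩, hi⟩
        · exact Or.inr hxS
    _ ≤ μ (⋃ i ∈ I, Metric.closedBall (c i) ε) + μ Sᶜ := measure_union_le _ _
    _ ≤ ν (⋃ i ∈ I, Metric.closedBall (y i) (3 * ε)) + ENNReal.ofReal ε := by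
        rw [hμ, add_zero]; exact hm I
    _ ≤ _ := by
        refine add_le_add (measure_mono ?_) (ENNReal.ofReal_le_ofReal (by linarith))
        intro z hz
        simp only [Set.mem_iUnion] at hz
        obtain ⟨i, ⟨x, hx, hxi⟩, hzi⟩ := hz
        rw [Metric.mem_closedBall] at hzi
        refine Metric.mem_cthickening_of_dist_le _ (f x) _ _ hx ?_
        have h1 := dist_triangle4 (g z) (g (y i)) (f (c i)) (f x)
        rw [hg.dist_eq, hf.dist_eq, dist_comm (g (y i)), dist_comm (c i)] at h1
        linarith [hd i]

theorem cGHP_le_of_net {𝒳 𝒴 : PMM} (S : SubPMM 𝒳) (T : SubPMM 𝒴) (hSc : IsCompact S.set)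
    (hTc : IsCompact T.set) {ι : Type} (i₀ : ι) (c : ι → 𝒳.carrier) (y : ι → 𝒴.carrier)
    {ε : ℝ} (hε : 0 < ε) (hc0 : c i₀ = 𝒳.basepoint) (hy0 : y i₀ = 𝒴.basepoint)
    (hcy : ∀ i j, |dist (c i) (c j) - dist (y i) (y j)| ≤ 2 * ε)
    (hS : ∀ a ∈ S.set, ∃ i, dist a (c i) ≤ ε ∧ ∃ b ∈ T.set, dist (y i) b ≤ 2 * ε)
    (hT : ∀ b ∈ T.set, ∃ i, dist b (y i) ≤ ε ∧ ∃ a ∈ S.set, dist (c i) a ≤ 2 * ε)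
    (hm : ∀ I : Set ι, S.meas (⋃ i ∈ I, Metric.closedBall (c i) ε) ≤
      T.meas (⋃ i ∈ I, Metric.closedBall (y i) (3 * ε)) + ENNReal.ofReal ε)
    (hm' : ∀ I : Set ι, T.meas (⋃ i ∈ I, Metric.closedBall (y i) ε) ≤
      S.meas (⋃ i ∈ I, Metric.closedBall (c i) (3 * ε)) + ENNReal.ofReal ε) :
    cGHP S.toPMM T.toPMM ≤ 5 * ε := by
  haveI : Nonempty ι := ⟨i₀⟩
  letI mZ : MetricSpace (𝒳.carrier ⊕ 𝒴.carrier) := Metric.glueMetricApprox c y ε hε hcy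
  letI : MeasurableSpace (𝒳.carrier ⊕ 𝒴.carrier) := borel _
  haveI : BorelSpace (𝒳.carrier ⊕ 𝒴.carrier) := ⟨rfl⟩
  have hf : Isometry (Sum.inl : 𝒳.carrier → 𝒳.carrier ⊕ 𝒴.carrier) :=
    Isometry.of_dist_eq fun _ _ => rfl
  have hg : Isometry (Sum.inr : 𝒴.carrier → 𝒳.carrier ⊕ 𝒴.carrier) :=
    Isometry.of_dist_eq fun _ _ => rfl
  have hd : ∀ i, dist (Sum.inl (c i) : 𝒳.carrier ⊕ 𝒴.carrier) (Sum.inr (y i)) = ε := fun i =>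
    Metric.glueDist_glued_points c y ε i
  have hfS : Isometry (fun a : S.toPMM.carrier => (Sum.inl a.1 : 𝒳.carrier ⊕ 𝒴.carrier)) :=
    hf.comp isometry_subtype_coe
  have hgT : Isometry (fun a : T.toPMM.carrier => (Sum.inr a.1 : 𝒳.carrier ⊕ 𝒴.carrier)) :=
    hg.comp isometry_subtype_coe
  let e : GHPEmbedding S.toPMM T.toPMM :=
    { Z := 𝒳.carrier ⊕ 𝒴.carrier
      mZ := mZ
      f := fun a => Sum.inl a.1
      g := fun b => Sum.inr b.1 }
  refine (cGHP_le e ⟨hfS, hgT⟩).trans ?_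
  have hfC : ∀ C : Set (𝒳.carrier ⊕ 𝒴.carrier), IsClosed C →
      S.toPMM.meas.map (fun a : S.toPMM.carrier => (Sum.inl a.1 : 𝒳.carrier ⊕ 𝒴.carrier)) C =
        S.meas (Sum.inl ⁻¹' C) := by
    intro C hC
    rw [Measure.map_apply hfS.continuous.measurable hC.measurableSet,
      ← S.toPMM_meas_preimage hSc.measurableSet (hC.preimage hf.continuous).measurableSet]
    rfl
  have hgC : ∀ C : Set (𝒳.carrier ⊕ 𝒴.carrier), IsClosed C →
      T.toPMM.meas.map (fun a : T.toPMM.carrier => (Sum.inr a.1 : 𝒳.carrier ⊕ 𝒴.carrier)) C =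
        T.meas (Sum.inr ⁻¹' C) := by
    intro C hC
    rw [Measure.map_apply hgT.continuous.measurable hC.measurableSet,
      ← T.toPMM_meas_preimage hTc.measurableSet (hC.preimage hg.continuous).measurableSet]
    rfl
  change max (dist (Sum.inl 𝒳.basepoint : 𝒳.carrier ⊕ 𝒴.carrier) (Sum.inr 𝒴.basepoint))
    (max (Metric.hausdorffDist
      (Set.range (fun a : S.toPMM.carrier => (Sum.inl a.1 : 𝒳.carrier ⊕ 𝒴.carrier)))
      (Set.range (fun a : T.toPMM.carrier => (Sum.inr a.1 : 𝒳.carrier ⊕ 𝒴.carrier))))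
      (prokhorovDist
        (S.toPMM.meas.map (fun a : S.toPMM.carrier => (Sum.inl a.1 : 𝒳.carrier ⊕ 𝒴.carrier)))
        (T.toPMM.meas.map (fun a : T.toPMM.carrier => (Sum.inr a.1 : 𝒳.carrier ⊕ 𝒴.carrier)))))
      ≤ 5 * ε
  refine max_le ?_ (max_le ?_ ?_)
  · rw [← hc0, ← hy0, hd]; linarith
  · refine Metric.hausdorffDist_le_of_mem_dist (by linarith) ?_ ?_
    · rintro _ ⟨a, rfl⟩
      obtain ⟨i, hi, b, hb, hib⟩ := hS a.1 a.2
      refine ⟨_, ⟨⟨b, hb⟩, rfl⟩, ?_⟩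
      have h1 := dist_triangle4 (Sum.inl a.1 : 𝒳.carrier ⊕ 𝒴.carrier) (Sum.inl (c i))
        (Sum.inr (y i)) (Sum.inr b)
      rw [hf.dist_eq, hg.dist_eq, hd] at h1
      show dist (Sum.inl a.1 : 𝒳.carrier ⊕ 𝒴.carrier) (Sum.inr b) ≤ _
      linarith
    · rintro _ ⟨b, rfl⟩
      obtain ⟨i, hi, a, ha, hia⟩ := hT b.1 b.2
      refine ⟨_, ⟨⟨a, ha⟩, rfl⟩, ?_⟩
      have h1 := dist_triangle4 (Sum.inr b.1 : 𝒳.carrier ⊕ 𝒴.carrier) (Sum.inr (y i))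
        (Sum.inl (c i)) (Sum.inl a)
      rw [hf.dist_eq, hg.dist_eq, dist_comm (Sum.inr (y i)), hd] at h1
      show dist (Sum.inr b.1 : 𝒳.carrier ⊕ 𝒴.carrier) (Sum.inl a) ≤ _
      linarith
  · refine csInf_le ⟨0, fun x hx => hx.1.le⟩ ⟨by linarith, fun C hC => ?_⟩
    rw [hfC _ hC, hgC _ hC, hfC _ Metric.isClosed_cthickening, hgC _ Metric.isClosed_cthickening]
    constructor
    · exact map_le_of_net _ _ hf hg c y hε (fun i => (hd i).le) S.set S.meas S.supported T.meas
        (fun a ha => (hS a ha).imp fun i hi => hi.1) hm C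
    · exact map_le_of_net _ _ hg hf y c hε (fun i => by rw [dist_comm]; exact (hd i).le)
        T.set T.meas T.supported S.meas
        (fun a ha => (hT a ha).imp fun i hi => hi.1) hm' C


abbrev UF : Filter ℕ := (hyperfilter ℕ : Filter ℕ)

theorem exists_tendsto_UF {u : ℕ → ℝ} {R : ℝ} (h : ∀ᶠ n in UF, |u n| ≤ R) :
    ∃ a, Tendsto u UF (𝓝 a) := by
  have hk : IsCompact (Set.Icc (-R) R) := isCompact_Icc
  have hmem : (Set.Icc (-R) R) ∈ (hyperfilter ℕ).map u := by
    change ∀ᶠ n in UF, u n ∈ Set.Icc (-R) R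
    filter_upwards [h] with n hn
    exact abs_le.1 hn
  obtain ⟨a, -, ha⟩ := hk.ultrafilter_le_nhds' _ hmem
  exact ⟨a, ha⟩

theorem exists_tendsto_UF_ennreal (u : ℕ → ENNReal) : ∃ a, Tendsto u UF (𝓝 a) := by
  obtain ⟨a, -, ha⟩ := (isCompact_univ (X := ENNReal)).ultrafilter_le_nhds' ((hyperfilter ℕ).map u)
    Filter.univ_mem
  exact ⟨a, ha⟩

theorem UF_pigeonhole {α : Type*} [Finite α] (p : ℕ → α) : ∃ a, ∀ᶠ n in UF, p n = a := by
  obtain ⟨a, ha⟩ := Ultrafilter.eq_pure_of_finite ((hyperfilter ℕ).map p)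
  refine ⟨a, ?_⟩
  have : ({a} : Set α) ∈ (hyperfilter ℕ).map p := by rw [ha]; exact Set.mem_singleton a
  exact this

theorem UF_eventually_or_not (p : ℕ → Prop) : (∀ᶠ n in UF, p n) ∨ (∀ᶠ n in UF, ¬ p n) :=
  Ultrafilter.eventually_or.1 (Eventually.of_forall fun n => em (p n))

theorem UF_frequently {p : ℕ → Prop} (h : ∀ᶠ n in UF, p n) : ∃ᶠ n in atTop, p n := by
  have h1 : ∃ᶠ n in UF, p n := h.frequently
  have h2 : UF ≤ (atTop : Filter ℕ) := by
    rw [← Nat.cofinite_eq_atTop]; exact hyperfilter_le_cofinite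
  exact h1.filter_mono h2

theorem UF_ge (k : ℕ) : ∀ᶠ n in UF, k ≤ n := by
  have h2 : UF ≤ (atTop : Filter ℕ) := by
    rw [← Nat.cofinite_eq_atTop]; exact hyperfilter_le_cofinite
  exact h2 (eventually_ge_atTop k)

/-- An ultralimit of a sequence of pointed metric spaces, described axiomatically. -/
structure ULim (X : ℕ → PMM) where
  Y : Type
  metric : MetricSpace Y
  o : Y
  rep : Y → ∀ n, (X n).carrier
  rep_o : ∀ n, rep o n = (X n).basepoint
  tendsto_dist : ∀ y z, Tendsto (fun n => dist (rep y n) (rep z n)) UF (𝓝 (dist y z))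
  exists_lim : ∀ (x : ∀ n, (X n).carrier) (R : ℝ),
    (∀ᶠ n in UF, dist (x n) (X n).basepoint ≤ R) →
    ∃ y, Tendsto (fun n => dist (x n) (rep y n)) UF (𝓝 0)

attribute [instance] ULim.metric

/-- Bounded sequences of points. -/
def BddSeq (X : ℕ → PMM) : Type :=
  {x : ∀ n, (X n).carrier // ∃ R : ℝ, ∀ n, dist (x n) (X n).basepoint ≤ R}

theorem BddSeq.bound {X : ℕ → PMM} (x y : BddSeq X) :
    ∃ R : ℝ, ∀ᶠ n in UF, |dist (x.1 n) (y.1 n)| ≤ R := by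
  obtain ⟨R, hR⟩ := x.2
  obtain ⟨R', hR'⟩ := y.2
  refine ⟨R + R', Eventually.of_forall fun n => ?_⟩
  rw [abs_of_nonneg dist_nonneg]
  have := dist_triangle_right (x.1 n) (y.1 n) (X n).basepoint
  linarith [hR n, hR' n]

def BddSeq.d {X : ℕ → PMM} (x y : BddSeq X) : ℝ :=
  (exists_tendsto_UF (BddSeq.bound x y).choose_spec).choose

theorem BddSeq.d_spec {X : ℕ → PMM} (x y : BddSeq X) :
    Tendsto (fun n => dist (x.1 n) (y.1 n)) UF (𝓝 (BddSeq.d x y)) :=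
  (exists_tendsto_UF (BddSeq.bound x y).choose_spec).choose_spec

instance (X : ℕ → PMM) : PseudoMetricSpace (BddSeq X) where
  dist := BddSeq.d
  dist_self x := by
    refine tendsto_nhds_unique (BddSeq.d_spec x x) ?_
    simp
  dist_comm x y := by
    refine tendsto_nhds_unique (BddSeq.d_spec x y) ?_
    simpa only [dist_comm] using (BddSeq.d_spec y x)
  dist_triangle x y z :=
    le_of_tendsto_of_tendsto (BddSeq.d_spec x z) ((BddSeq.d_spec x y).add (BddSeq.d_spec y z))
      (Eventually.of_forall fun n => dist_triangle _ _ _)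

theorem exists_ULim (X : ℕ → PMM) : Nonempty (ULim X) := by
  classical
  let b : BddSeq X := ⟨fun n => (X n).basepoint, 0, fun n => by simp⟩
  let Q := SeparationQuotient (BddSeq X)
  let o : Q := SeparationQuotient.mk b
  have hsurj := SeparationQuotient.surjective_mk (X := BddSeq X)
  let r : Q → BddSeq X := fun q => if q = o then b else Function.surjInv hsurj q
  have hr : ∀ q, SeparationQuotient.mk (r q) = q := by
    intro q
    by_cases h : q = o
    · simp only [r, h, if_true]; rfl
    · simp only [r, h, if_false]; exact Function.surjInv_eq hsurj q
  refine ⟨⟨Q, inferInstance, o, fun q => (r q).1, ?_, ?_, ?_⟩⟩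
  · intro n; simp only [r, if_true]; rfl
  · intro y z
    have h1 : dist y z = dist (r y) (r z) := by
      conv_lhs => rw [← hr y, ← hr z]
      exact SeparationQuotient.dist_mk _ _
    rw [h1]
    exact BddSeq.d_spec (r y) (r z)
  · intro x R hR
    let x' : BddSeq X := ⟨fun n => if dist (x n) (X n).basepoint ≤ R then x n else (X n).basepoint,
      max R 0, fun n => by
        by_cases h : dist (x n) (X n).basepoint ≤ R
        · simp [h]
        · simp [h]⟩
    refine ⟨SeparationQuotient.mk x', ?_⟩
    have h1 : dist x' (r (SeparationQuotient.mk x')) = 0 := by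
      rw [← SeparationQuotient.dist_mk, hr, dist_self]
    have h2 := BddSeq.d_spec x' (r (SeparationQuotient.mk x'))
    have h3 : BddSeq.d x' (r (SeparationQuotient.mk x')) = 0 := h1
    rw [h3] at h2
    refine h2.congr' ?_
    filter_upwards [hR] with n hn
    simp [x', hn]

namespace ULim
variable {X : ℕ → PMM} (L : ULim X)

theorem rep_bdd (y : L.Y) {R : ℝ} (h : dist y L.o < R) :
    ∀ᶠ n in UF, dist (L.rep y n) (X n).basepoint < R := by
  have h1 := L.tendsto_dist y L.o
  simp only [L.rep_o] at h1
  exact h1.eventually_lt_const h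

/-- Distance between a limit point and a sequence. -/
theorem tendsto_dist_of {x x' : ∀ n, (X n).carrier} {y y' : L.Y}
    (h : Tendsto (fun n => dist (x n) (L.rep y n)) UF (𝓝 0))
    (h' : Tendsto (fun n => dist (x' n) (L.rep y' n)) UF (𝓝 0)) :
    Tendsto (fun n => dist (x n) (x' n)) UF (𝓝 (dist y y')) := by
  have h1 := L.tendsto_dist y y'
  have h2 := h1.sub (h.add h')
  have h3 := h1.add (h.add h')
  simp only [add_zero, sub_zero] at h2 h3
  refine tendsto_of_tendsto_of_tendsto_of_le_of_le h2 h3 (fun n => ?_) (fun n => ?_)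
  · have := dist_triangle4 (L.rep y n) (x n) (x' n) (L.rep y' n)
    rw [dist_comm (L.rep y n) (x n)] at this
    show dist (L.rep y n) (L.rep y' n) - (dist (x n) (L.rep y n) + dist (x' n) (L.rep y' n)) ≤ _
    linarith
  · have := dist_triangle4 (x n) (L.rep y n) (L.rep y' n) (x' n)
    rw [dist_comm (L.rep y' n) (x' n)] at this
    show _ ≤ dist (L.rep y n) (L.rep y' n) + (dist (x n) (L.rep y n) + dist (x' n) (L.rep y' n))
    linarith

theorem tendsto_rep (y : L.Y) : Tendsto (fun n => dist (L.rep y n) (L.rep y n)) UF (𝓝 0) := by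
  simp

theorem tendsto_base : Tendsto (fun n => dist (X n).basepoint (L.rep L.o n)) UF (𝓝 0) := by
  simp [L.rep_o]

theorem completeSpace : CompleteSpace L.Y := by
  classical
  refine Metric.complete_of_convergent_controlled_sequences (fun n => (1/2 : ℝ)^n)
    (fun n => by positivity) ?_
  intro u hu
  let Sm : ℕ → ℕ → Prop := fun m n => ∀ j ≤ m, ∀ k ≤ m, j ≤ k →
    dist (L.rep (u j) n) (L.rep (u k) n) < (1/2 : ℝ)^j
  have hS0 : ∀ n, Sm 0 n := by
    intro n j hj k hk hjk
    have : j = 0 := by omega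
    have : k = 0 := by omega
    subst_vars
    simp
  have hSm : ∀ m, ∀ᶠ n in UF, Sm m n := by
    intro m
    have : ∀ j ∈ Finset.range (m+1), ∀ k ∈ Finset.range (m+1), ∀ᶠ n in UF, j ≤ k →
        dist (L.rep (u j) n) (L.rep (u k) n) < (1/2 : ℝ)^j := by
      intro j _ k _
      by_cases hjk : j ≤ k
      · have h1 := hu j j k le_rfl hjk
        filter_upwards [(L.tendsto_dist (u j) (u k)).eventually_lt_const h1] with n hn _
        exact hn
      · exact Eventually.of_forall fun n h => absurd h hjk
    have h2 : ∀ᶠ n in UF, ∀ j ∈ Finset.range (m+1), ∀ k ∈ Finset.range (m+1), j ≤ k →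
        dist (L.rep (u j) n) (L.rep (u k) n) < (1/2 : ℝ)^j := by
      rw [Filter.eventually_all_finset]
      intro j hj
      rw [Filter.eventually_all_finset]
      intro k hk
      exact this j hj k hk
    filter_upwards [h2] with n hn j hj k hk hjk
    exact hn j (Finset.mem_range.2 (by omega)) k (Finset.mem_range.2 (by omega)) hjk
  let M : ℕ → ℕ := fun n => Nat.findGreatest (fun m => Sm m n) n
  have hM : ∀ n, Sm (M n) n := fun n =>
    Nat.findGreatest_spec (P := fun m => Sm m n) (Nat.zero_le n) (hS0 n)
  let x : ∀ n, (X n).carrier := fun n => L.rep (u (M n)) n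
  have hx : ∀ k, ∀ᶠ n in UF, dist (L.rep (u k) n) (x n) ≤ (1/2 : ℝ)^k := by
    intro k
    filter_upwards [hSm k, UF_ge k] with n hn hkn
    have hk : k ≤ M n := Nat.le_findGreatest hkn hn
    exact (hM n k hk (M n) le_rfl hk).le
  obtain ⟨y, hy⟩ := L.exists_lim x (dist (u 0) L.o + 1 + (1/2 : ℝ)^0) (by
    filter_upwards [hx 0, L.rep_bdd (u 0) (lt_add_one _)] with n h1 h2
    have := dist_triangle_left (x n) (X n).basepoint (L.rep (u 0) n)
    linarith)
  refine ⟨y, ?_⟩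
  rw [tendsto_iff_dist_tendsto_zero]
  refine squeeze_zero (fun _ => dist_nonneg) (fun k => ?_)
    (tendsto_pow_atTop_nhds_zero_of_lt_one (by norm_num) (by norm_num : (1/2:ℝ) < 1))
  exact le_of_tendsto (L.tendsto_dist_of (L.tendsto_rep (u k)) hy) (hx k)

/-- The uniform precompactness condition on a sequence of spaces. -/
def _root_.UnifSmall (X : ℕ → PMM) : Prop :=
  ∀ r ε : ℝ, 0 ≤ r → 0 < ε → ∃ N : ℕ, ∀ n,
    NetSmall N ε (Metric.closedBall (X n).basepoint r) ∧
      (X n).meas (Metric.closedBall (X n).basepoint r) ≤ N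

theorem isCompact_closedBall (hX : UnifSmall X) (y : L.Y) (r : ℝ) :
    IsCompact (Metric.closedBall y r) := by
  haveI := L.completeSpace
  suffices h : ∀ R : ℝ, 0 ≤ R → IsCompact (Metric.closedBall L.o R) by
    refine (h (max 0 (r + dist y L.o)) (le_max_left _ _)).of_isClosed_subset
      Metric.isClosed_closedBall (Metric.closedBall_subset_closedBall' (le_max_right _ _))
  intro R hR
  refine TotallyBounded.isCompact_of_isClosed ?_ Metric.isClosed_closedBall
  rw [Metric.totallyBounded_iff]
  intro ε hε
  obtain ⟨N, hN⟩ := hX (R+1) (ε/2) (by linarith) (half_pos hε)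
  choose p hp using fun n => (hN n).1
  have hq : ∀ y : L.Y, ∃ i : Fin N, ∀ᶠ n in UF, p n (L.rep y n) = i := fun y => UF_pigeonhole _
  choose q hq using hq
  have hd : ∀ y ∈ Metric.closedBall L.o R, ∀ z ∈ Metric.closedBall L.o R, q y = q z →
      dist y z ≤ ε/2 := by
    intro y hy z hz hyz
    have hy' := L.rep_bdd y (lt_of_le_of_lt hy (lt_add_one R))
    have hz' := L.rep_bdd z (lt_of_le_of_lt hz (lt_add_one R))
    refine le_of_tendsto (L.tendsto_dist y z) ?_
    filter_upwards [hq y, hq z, hy', hz'] with n h1 h2 h3 h4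
    exact hp n _ h3.le _ h4.le (by rw [h1, h2, hyz])
  have hc : ∀ i : Fin N, ∃ c : L.Y, ∀ y ∈ Metric.closedBall L.o R, q y = i → dist y c ≤ ε/2 := by
    intro i
    by_cases h : ∃ c ∈ Metric.closedBall L.o R, q c = i
    · obtain ⟨c, hc, hci⟩ := h
      exact ⟨c, fun y hy hyi => hd y hy c hc (by rw [hyi, hci])⟩
    · push Not at h
      exact ⟨L.o, fun y hy hyi => absurd hyi (h y hy)⟩
  choose c hc using hc
  refine ⟨Set.range c, Set.finite_range c, fun y hy => ?_⟩
  simp only [Set.mem_iUnion]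
  exact ⟨c (q y), Set.mem_range_self _, lt_of_le_of_lt (hc _ y hy rfl) (half_lt_self hε)⟩

end ULim


/-- Ultrafilter limit in `[0,∞]`. -/
def ulim (u : ℕ → ENNReal) : ENNReal := (exists_tendsto_UF_ennreal u).choose

theorem ulim_spec (u : ℕ → ENNReal) : Tendsto u UF (𝓝 (ulim u)) :=
  (exists_tendsto_UF_ennreal u).choose_spec

theorem ulim_mono {u v : ℕ → ENNReal} (h : ∀ᶠ n in UF, u n ≤ v n) : ulim u ≤ ulim v :=
  le_of_tendsto_of_tendsto (ulim_spec u) (ulim_spec v) h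

theorem ulim_add (u v : ℕ → ENNReal) : ulim (fun n => u n + v n) = ulim u + ulim v :=
  tendsto_nhds_unique (ulim_spec _) ((ulim_spec u).add (ulim_spec v))

theorem ulim_const (a : ENNReal) : ulim (fun _ => a) = a :=
  tendsto_nhds_unique (ulim_spec _) tendsto_const_nhds

namespace ULim
variable {X : ℕ → PMM} (L : ULim X)

instance : MeasurableSpace L.Y := borel L.Y
instance : BorelSpace L.Y := ⟨rfl⟩

/-- The sequence of sets `A` is a neighbourhood of `K`. -/
def Nb (A : ∀ n, Set (X n).carrier) (K : Set L.Y) : Prop :=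
  ∀ y ∈ K, ∃ s > 0, ∀ᶠ n in UF, Metric.ball (L.rep y n) s ⊆ A n

/-- The content of a set. -/
def lam (m : ∀ n, Measure (X n).carrier) (K : Set L.Y) : ENNReal :=
  ⨅ A : {A : ∀ n, Set (X n).carrier // (∀ n, MeasurableSet (A n)) ∧ L.Nb A K},
    ulim (fun n => m n (A.1 n))

variable {L}

theorem lam_le (m : ∀ n, Measure (X n).carrier) {K : Set L.Y} {A : ∀ n, Set (X n).carrier}
    (hA : ∀ n, MeasurableSet (A n)) (hK : L.Nb A K) : L.lam m K ≤ ulim (fun n => m n (A n)) :=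
  iInf_le (fun A : {A : ∀ n, Set (X n).carrier // (∀ n, MeasurableSet (A n)) ∧ L.Nb A K} =>
    ulim (fun n => m n (A.1 n))) ⟨A, hA, hK⟩

theorem le_lam {m : ∀ n, Measure (X n).carrier} {K : Set L.Y} {a : ENNReal}
    (h : ∀ A : ∀ n, Set (X n).carrier, (∀ n, MeasurableSet (A n)) → L.Nb A K →
      a ≤ ulim (fun n => m n (A n))) : a ≤ L.lam m K :=
  le_iInf fun A => h A.1 A.2.1 A.2.2

theorem Nb.mono {A B : ∀ n, Set (X n).carrier} {K K' : Set L.Y} (h : L.Nb A K)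
    (hAB : ∀ n, A n ⊆ B n) (hK : K' ⊆ K) : L.Nb B K' := fun y hy => by
  obtain ⟨s, hs, h1⟩ := h y (hK hy)
  exact ⟨s, hs, h1.mono fun n hn => hn.trans (hAB n)⟩

theorem Nb.inter {A B : ∀ n, Set (X n).carrier} {K : Set L.Y} (h : L.Nb A K) (h' : L.Nb B K) :
    L.Nb (fun n => A n ∩ B n) K := fun y hy => by
  obtain ⟨s, hs, h1⟩ := h y hy
  obtain ⟨t, ht, h2⟩ := h' y hy
  refine ⟨min s t, lt_min hs ht, ?_⟩
  filter_upwards [h1, h2] with n h1 h2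
  exact Set.subset_inter ((Metric.ball_subset_ball (min_le_left _ _)).trans h1)
    ((Metric.ball_subset_ball (min_le_right _ _)).trans h2)

theorem Nb.union {A B : ∀ n, Set (X n).carrier} {K K' : Set L.Y} (h : L.Nb A K)
    (h' : L.Nb B K') : L.Nb (fun n => A n ∪ B n) (K ∪ K') := by
  rintro y (hy | hy)
  · exact h.mono (fun n => Set.subset_union_left) le_rfl y hy
  · exact h'.mono (fun n => Set.subset_union_right) le_rfl y hy

theorem nb_ball {x : ∀ n, (X n).carrier} {z : L.Y} {t t' : ℝ}
    (hx : Tendsto (fun n => dist (x n) (L.rep z n)) UF (𝓝 0)) (htt' : t < t') :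
    L.Nb (fun n => Metric.ball (x n) t') (Metric.closedBall z t) := by
  intro y hy
  rw [Metric.mem_closedBall] at hy
  refine ⟨(t' - t)/2, by linarith, ?_⟩
  have h1 := L.tendsto_dist_of (L.tendsto_rep y) hx
  filter_upwards [h1.eventually_lt_const (show dist y z < t + (t'-t)/2 by linarith)] with n hn
  refine Metric.ball_subset_ball' ?_
  linarith

theorem lam_mono_set (m : ∀ n, Measure (X n).carrier) {K K' : Set L.Y} (h : K ⊆ K') :
    L.lam m K ≤ L.lam m K' :=
  le_lam fun A hA hK => lam_le m hA (hK.mono (fun _ => le_rfl) h)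

theorem lam_union_le (m : ∀ n, Measure (X n).carrier) (K K' : Set L.Y) :
    L.lam m (K ∪ K') ≤ L.lam m K + L.lam m K' := by
  unfold lam
  rw [ENNReal.iInf_add]
  refine le_iInf fun A => ?_
  rw [ENNReal.add_iInf]
  refine le_iInf fun B => ?_
  rw [← ulim_add]
  refine (lam_le m (fun n => (A.2.1 n).union (B.2.1 n)) (A.2.2.union B.2.2)).trans ?_
  exact ulim_mono (Eventually.of_forall fun n => measure_union_le _ _)

theorem lam_union_ge (m : ∀ n, Measure (X n).carrier) {K K' : Set L.Y} (hK : IsCompact K)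
    (hK' : IsClosed K') (hd : Disjoint K K') :
    L.lam m K + L.lam m K' ≤ L.lam m (K ∪ K') := by
  refine le_lam fun A hA hAK => ?_
  obtain ⟨η, hη, hdis⟩ := hd.exists_thickenings hK hK'
  obtain ⟨F, hFK, hF, hcov⟩ := hK.finite_cover_balls (show 0 < η/3 by linarith)
  let G : ∀ n, Set (X n).carrier := fun n => ⋃ z ∈ F, Metric.ball (L.rep z n) (η/2)
  have hGm : ∀ n, MeasurableSet (G n) := fun n =>
    (isOpen_biUnion fun z _ => Metric.isOpen_ball).measurableSet
  have hG : L.Nb G K := by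
    intro y hy
    have := hcov hy
    simp only [Set.mem_iUnion] at this
    obtain ⟨z, hz, hyz⟩ := this
    refine (nb_ball (L.tendsto_rep z) (show η/3 < η/2 by linarith)).mono ?_ le_rfl y
      (Metric.ball_subset_closedBall hyz)
    intro n
    exact Set.subset_biUnion_of_mem (u := fun z => Metric.ball (L.rep z n) (η/2)) hz
  have hG' : L.Nb (fun n => (G n)ᶜ) K' := by
    intro y hy
    refine ⟨η/4, by linarith, ?_⟩
    have hdist : ∀ z ∈ F, ∀ᶠ n in UF, 3*η/4 < dist (L.rep z n) (L.rep y n) := by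
      intro z hz
      have h1 : η ≤ dist z y := by
        by_contra hlt
        push Not at hlt
        exact Set.disjoint_left.1 hdis (Metric.mem_thickening_iff.2 ⟨z, hFK hz, by rwa [dist_comm]⟩)
          (Metric.self_subset_thickening hη K' hy)
      exact (L.tendsto_dist z y).eventually_const_lt (by linarith)
    rw [← Filter.eventually_all_finite hF] at hdist
    filter_upwards [hdist] with n hn x hx hxG
    simp only [G, Set.mem_iUnion, Metric.mem_ball] at hxG
    obtain ⟨z, hz, hxz⟩ := hxG
    rw [Metric.mem_ball] at hx
    have := dist_triangle_left (L.rep z n) (L.rep y n) x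
    linarith [hn z hz]
  have h1 := lam_le m (fun n => (hA n).inter (hGm n))
    ((hAK.mono (fun _ => le_rfl) Set.subset_union_left).inter hG)
  have h2 := lam_le m (fun n => (hA n).inter (hGm n).compl)
    ((hAK.mono (fun _ => le_rfl) Set.subset_union_right).inter hG')
  refine (add_le_add h1 h2).trans ?_
  rw [← ulim_add]
  refine ulim_mono (Eventually.of_forall fun n => ?_)
  rw [← Set.sdiff_eq, measure_inter_add_sdiff _ (hGm n)]

/-- The measures are uniformly finite on balls. -/
def _root_.UnifFin {X : ℕ → PMM} (m : ∀ n, Measure (X n).carrier) : Prop :=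
  ∀ R : ℝ, ∃ M : ℕ, ∀ n, m n (Metric.closedBall (X n).basepoint R) ≤ M

theorem lam_ne_top {m : ∀ n, Measure (X n).carrier} (hm : UnifFin m) {K : Set L.Y}
    (hK : IsCompact K) : L.lam m K ≠ ⊤ := by
  obtain ⟨R, hR⟩ := hK.isBounded.subset_closedBall L.o
  obtain ⟨M, hM⟩ := hm (R+1)
  have h1 := lam_le m (fun n => measurableSet_ball)
    ((nb_ball L.tendsto_base (lt_add_one R)).mono (fun _ => le_rfl) hR)
  refine ne_top_of_le_ne_top (ENNReal.natCast_ne_top M) (h1.trans ?_)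
  rw [← ulim_const (M : ENNReal)]
  exact ulim_mono (Eventually.of_forall fun n =>
    (measure_mono Metric.ball_subset_closedBall).trans (hM n))

variable (L)

/-- The content on the ultralimit. -/
def content {m : ∀ n, Measure (X n).carrier} (hm : UnifFin m) : Content L.Y where
  toFun K := (L.lam m K).toNNReal
  mono' K K' h := ENNReal.toNNReal_mono (lam_ne_top hm K'.isCompact) (lam_mono_set m h)
  sup_disjoint' K K' h h1 h2 := by
    rw [← ENNReal.toNNReal_add (lam_ne_top hm K.isCompact) (lam_ne_top hm K'.isCompact)]
    congr 1
    exact le_antisymm (lam_union_le m _ _) (lam_union_ge m K.isCompact h2 h)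
  sup_le' K K' := by
    rw [← ENNReal.toNNReal_add (lam_ne_top hm K.isCompact) (lam_ne_top hm K'.isCompact)]
    refine ENNReal.toNNReal_mono ?_ (lam_union_le m _ _)
    exact ENNReal.add_ne_top.2 ⟨lam_ne_top hm K.isCompact, lam_ne_top hm K'.isCompact⟩

theorem content_apply {m : ∀ n, Measure (X n).carrier} (hm : UnifFin m)
    (K : TopologicalSpace.Compacts L.Y) : L.content hm K = L.lam m K := by
  change (((L.lam m K).toNNReal : NNReal) : ENNReal) = _
  exact ENNReal.coe_toNNReal (lam_ne_top hm K.isCompact)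

/-- The limit measure. -/
def nu {m : ∀ n, Measure (X n).carrier} (hm : UnifFin m) : Measure L.Y := (L.content hm).measure

variable {L}

theorem lam_le_nu {m : ∀ n, Measure (X n).carrier} (hm : UnifFin m) {K : Set L.Y}
    (hK : IsCompact K) : L.lam m K ≤ L.nu hm K := by
  have := (L.content hm).le_outerMeasure_compacts ⟨K, hK⟩
  rw [content_apply] at this
  rw [nu, Content.measure_apply _ hK.measurableSet]
  exact this

theorem nu_le {m : ∀ n, Measure (X n).carrier} (hm : UnifFin m) {K K' : Set L.Y}
    (hK' : IsCompact K') (hKK' : K ⊆ interior K') {A : ∀ n, Set (X n).carrier}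
    (hA : ∀ n, MeasurableSet (A n)) (hAK : L.Nb A K') :
    L.nu hm K ≤ ulim (fun n => m n (A n)) := by
  refine (measure_mono hKK').trans ?_
  have := (L.content hm).outerMeasure_interior_compacts ⟨K', hK'⟩
  rw [content_apply] at this
  rw [nu, Content.measure_apply _ isOpen_interior.measurableSet]
  exact this.trans (lam_le m hA hAK)

theorem ulim_le_nu {m : ∀ n, Measure (X n).carrier} (hm : UnifFin m) {K : Set L.Y}
    (hK : IsCompact K) {A : ∀ n, Set (X n).carrier} {R : ℝ}
    (hR : ∀ n, A n ⊆ Metric.closedBall (X n).basepoint R)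
    (hA : ∀ x : ∀ n, (X n).carrier, (∀ᶠ n in UF, x n ∈ A n) → ∀ y,
      Tendsto (fun n => dist (x n) (L.rep y n)) UF (𝓝 0) → y ∈ K) :
    ulim (fun n => m n (A n)) ≤ L.nu hm K := by
  classical
  refine le_trans (le_lam fun B hB hBK => ulim_mono ?_) (lam_le_nu hm hK)
  suffices h : ∀ᶠ n in UF, A n ⊆ B n from h.mono fun n hn => measure_mono hn
  rcases UF_eventually_or_not (fun n => A n ⊆ B n) with h | h
  · exact h
  exfalso
  let x : ∀ n, (X n).carrier := fun n =>
    if h : ∃ x ∈ A n, x ∉ B n then h.choose else (X n).basepoint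
  have hx : ∀ᶠ n in UF, x n ∈ A n ∧ x n ∉ B n := by
    filter_upwards [h] with n hn
    rw [Set.not_subset] at hn
    simp only [x, dif_pos hn]
    exact hn.choose_spec
  obtain ⟨y, hy⟩ := L.exists_lim x R (hx.mono fun n hn => hR n hn.1)
  obtain ⟨s, hs, hsB⟩ := hBK y (hA x (hx.mono fun n hn => hn.1) y hy)
  obtain ⟨n, h1, h2, h3⟩ := (hx.and (hsB.and (hy.eventually_lt_const hs))).exists
  exact h1.2 (h2 (by simpa using h3))

/-- Comparison of limit measures on subsets of an open set. -/
theorem nu_mono_on {m m' : ∀ n, Measure (X n).carrier} (hm : UnifFin m) (hm' : UnifFin m')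
    {G : Set L.Y} (hG : IsOpen G) (h : ∀ K ⊆ G, IsCompact K → L.lam m K ≤ L.lam m' K)
    {E : Set L.Y} (hE : MeasurableSet E) (hEG : E ⊆ G) : L.nu hm E ≤ L.nu hm' E := by
  have hreg : (L.nu hm').OuterRegular := by unfold nu; infer_instance
  rw [Set.measure_eq_iInf_isOpen E (L.nu hm')]
  refine le_iInf₂ fun O hEO => le_iInf fun hO => ?_
  calc L.nu hm E ≤ L.nu hm (O ∩ G) := measure_mono (Set.subset_inter hEO hEG)
    _ ≤ L.nu hm' (O ∩ G) := by
        have hOG := hO.inter hG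
        rw [nu, nu, Content.measure_apply _ hOG.measurableSet,
          Content.measure_apply _ hOG.measurableSet, Content.outerMeasure_of_isOpen _ _ hOG,
          Content.outerMeasure_of_isOpen _ _ hOG]
        refine iSup₂_le fun K hK => ?_
        refine le_trans ?_ ((L.content hm').le_innerContent K _ hK)
        rw [content_apply, content_apply]
        exact h K (hK.trans Set.inter_subset_right) K.isCompact
    _ ≤ _ := measure_mono Set.inter_subset_left

theorem nu_eq_zero {m : ∀ n, Measure (X n).carrier} (hm : UnifFin m) {G : Set L.Y} (hG : IsOpen G)
    {A : ∀ n, Set (X n).carrier} (hA : ∀ n, MeasurableSet (A n)) (hAG : L.Nb A G)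
    (h0 : ∀ n, m n (A n) = 0) : L.nu hm G = 0 := by
  rw [nu, Content.measure_apply _ hG.measurableSet, Content.outerMeasure_of_isOpen _ _ hG]
  refine le_antisymm (iSup₂_le fun K hK => ?_) zero_le
  rw [content_apply]
  refine (lam_le m hA (hAG.mono (fun _ => le_rfl) hK)).trans ?_
  simp [h0, ulim_const]

end ULim


theorem eventually_le_of_ulim_le {u : ℕ → ENNReal} {a : ENNReal} {ε : ℝ} (hε : 0 < ε)
    (ha : a ≠ ⊤) (h : ulim u ≤ a) : ∀ᶠ n in UF, u n ≤ a + ENNReal.ofReal ε := by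
  have h1 : ulim u < a + ENNReal.ofReal ε :=
    lt_of_le_of_lt h (ENNReal.lt_add_right ha (ENNReal.ofReal_pos.2 hε).ne')
  exact ((ulim_spec u).eventually_lt_const h1).mono fun n hn => hn.le

theorem eventually_le_of_le_ulim {u : ℕ → ENNReal} {a : ENNReal} {ε : ℝ} (hε : 0 < ε)
    (ha : a ≠ ⊤) (h : a ≤ ulim u) : ∀ᶠ n in UF, a ≤ u n + ENNReal.ofReal ε := by
  have h1 : a < ulim u + ENNReal.ofReal ε :=
    lt_of_lt_of_le (ENNReal.lt_add_right ha (ENNReal.ofReal_pos.2 hε).ne')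
      (add_le_add h le_rfl)
  exact (((ulim_spec u).add_const _).eventually_const_lt h1).mono fun n hn => hn.le

theorem PMM.ballSub_set (𝒳 : PMM) {r : ℝ} (hr : 0 ≤ r) :
    (𝒳.ballSub r).set = Metric.closedBall 𝒳.basepoint r :=
  Set.insert_eq_of_mem (Metric.mem_closedBall_self hr)

theorem PMM.ballSub_meas (𝒳 : PMM) {r : ℝ} (hr : 0 ≤ r) :
    (𝒳.ballSub r).meas = 𝒳.meas.restrict (Metric.closedBall 𝒳.basepoint r) := by
  change 𝒳.meas.restrict (𝒳.ballSub r).set = _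
  rw [𝒳.ballSub_set hr]

theorem PMM.ballSub_compact {𝒳 : PMM} (h : 𝒳.BoundedlyCompact) (r : ℝ) :
    (𝒳.ballSub r).IsCompactSub := by
  constructor
  · exact (h.1 _ r).insert _
  · change 𝒳.meas.restrict (insert 𝒳.basepoint (Metric.closedBall 𝒳.basepoint r)) Set.univ ≠ ⊤
    rw [Measure.restrict_apply_univ]
    refine ne_top_of_le_ne_top (h.2 𝒳.basepoint (max r 0)) (measure_mono ?_)
    rintro x (rfl | hx)
    · simp
    · exact Metric.closedBall_subset_closedBall (le_max_left _ _) hx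

theorem PMM.ballSub_mono (𝒳 : PMM) {r s : ℝ} (h : r ≤ s) : 𝒳.ballSub r ≤ 𝒳.ballSub s := by
  have h1 : insert 𝒳.basepoint (Metric.closedBall 𝒳.basepoint r) ⊆
      insert 𝒳.basepoint (Metric.closedBall 𝒳.basepoint s) :=
    Set.insert_subset_insert (Metric.closedBall_subset_closedBall h)
  exact ⟨h1, Measure.restrict_mono_set _ h1⟩

theorem unifFin_meas {X : ℕ → PMM} (hX : UnifSmall X) : UnifFin (fun n => (X n).meas) := by
  intro R
  obtain ⟨N, hN⟩ := hX (max R 0) 1 (le_max_right _ _) one_pos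
  exact ⟨N, fun n => (measure_mono (Metric.closedBall_subset_closedBall (le_max_left _ _))).trans
    (hN n).2⟩

theorem unifFin_ball {X : ℕ → PMM} (hX : UnifSmall X) (r : ℝ) :
    UnifFin (fun n => ((X n).ballSub r).meas) := by
  intro R
  obtain ⟨M, hM⟩ := unifFin_meas hX R
  exact ⟨M, fun n => (((X n).ballSub r).meas_le _).trans (hM n)⟩

namespace ULim
variable {X : ℕ → PMM} (L : ULim X)

/-- The ultralimit as a pmm space. -/
abbrev pmm {m : ∀ n, Measure (X n).carrier} (hm : UnifFin m) : PMM where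
  carrier := L.Y
  metric := L.metric
  basepoint := L.o
  meas := L.nu hm

variable {L}

theorem nu_closedBall_ne_top (hX : UnifSmall X) {m : ∀ n, Measure (X n).carrier} (hm : UnifFin m)
    (y : L.Y) (R : ℝ) : L.nu hm (Metric.closedBall y R) ≠ ⊤ := by
  set R' := R + dist y L.o
  obtain ⟨M, hM⟩ := hm (R'+2)
  refine ne_top_of_le_ne_top (ENNReal.natCast_ne_top M) ?_
  rw [← ulim_const (M : ENNReal)]
  refine (nu_le hm (L.isCompact_closedBall hX L.o (R'+1)) ?_ (fun n => measurableSet_ball)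
    (nb_ball L.tendsto_base (show R'+1 < R'+2 by linarith))).trans ?_
  · refine (show Metric.closedBall y R ⊆ Metric.closedBall L.o R' from
      Metric.closedBall_subset_closedBall' le_rfl).trans
      (subset_trans ?_ Metric.ball_subset_interior_closedBall)
    exact Metric.closedBall_subset_ball (lt_add_one R')
  · exact ulim_mono (Eventually.of_forall fun n =>
      (measure_mono Metric.ball_subset_closedBall).trans (hM n))

theorem pmm_boundedlyCompact (hX : UnifSmall X) {m : ∀ n, Measure (X n).carrier}
    (hm : UnifFin m) : (L.pmm hm).BoundedlyCompact :=
  ⟨fun x r => L.isCompact_closedBall hX x r, fun x r => nu_closedBall_ne_top hX hm x r⟩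

theorem net_compact {ι : Type} [Finite ι] {y : ι → L.Y} (hX : UnifSmall X) (I : Set ι) (t : ℝ) :
    IsCompact (⋃ i ∈ I, Metric.closedBall (y i) t) :=
  (Set.toFinite I).isCompact_biUnion fun i _ => L.isCompact_closedBall hX _ _

theorem net_ulim_le {ι : Type} [Finite ι] {c : ∀ n, ι → (X n).carrier} {y : ι → L.Y}
    (hcy : ∀ i, Tendsto (fun n => dist (c n i) (L.rep (y i) n)) UF (𝓝 0))
    (hX : UnifSmall X) {m : ∀ n, Measure (X n).carrier} (hm : UnifFin m)
    (I : Set ι) (t ρ : ℝ) :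
    ulim (fun n => m n ((⋃ i ∈ I, Metric.closedBall (c n i) t) ∩
      Metric.closedBall (X n).basepoint ρ)) ≤
      L.nu hm ((⋃ i ∈ I, Metric.closedBall (y i) t) ∩ Metric.closedBall L.o ρ) := by
  refine ulim_le_nu hm ((net_compact hX I t).inter_right Metric.isClosed_closedBall)
    (R := ρ) (fun n => Set.inter_subset_right) ?_
  intro x hx z hz
  constructor
  · have h1 : ∀ᶠ n in UF, ∃ i ∈ I, dist (x n) (c n i) ≤ t := by
      filter_upwards [hx] with n hn
      simpa using hn.1
    have h2 : ∃ i, ∀ᶠ n in UF, i ∈ I ∧ dist (x n) (c n i) ≤ t := by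
      classical
      let p : ℕ → Option ι := fun n =>
        if h : ∃ i ∈ I, dist (x n) (c n i) ≤ t then some h.choose else none
      obtain ⟨a, ha⟩ := UF_pigeonhole p
      have h3 : ∀ᶠ n in UF, ∃ i, a = some i ∧ i ∈ I ∧ dist (x n) (c n i) ≤ t := by
        filter_upwards [ha, h1] with n hn hn'
        refine ⟨hn'.choose, ?_, hn'.choose_spec⟩
        rw [← hn]
        simp only [p, dif_pos hn']
      obtain ⟨n, i, hi, -⟩ := h3.exists
      refine ⟨i, ?_⟩
      filter_upwards [h3] with n hn
      obtain ⟨j, hj, hj'⟩ := hn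
      have : i = j := by rw [hi] at hj; exact Option.some.inj hj
      rw [this]; exact hj'
    obtain ⟨i, hi⟩ := h2
    simp only [Set.mem_iUnion]
    refine ⟨i, hi.exists.choose_spec.1, ?_⟩
    exact le_of_tendsto (L.tendsto_dist_of hz (hcy i)) (hi.mono fun n hn => hn.2)
  · exact le_of_tendsto (L.tendsto_dist_of hz L.tendsto_base) (hx.mono fun n hn => hn.2)

theorem net_le_ulim {ι : Type} [Finite ι] {c : ∀ n, ι → (X n).carrier} {y : ι → L.Y}
    (hcy : ∀ i, Tendsto (fun n => dist (c n i) (L.rep (y i) n)) UF (𝓝 0))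
    (hX : UnifSmall X) {m : ∀ n, Measure (X n).carrier} (hm : UnifFin m)
    (I : Set ι) {t t' ρ ρ' : ℝ} (ht : t < t') (hρ : ρ < ρ') :
    L.nu hm ((⋃ i ∈ I, Metric.closedBall (y i) t) ∩ Metric.closedBall L.o ρ) ≤
    ulim (fun n => m n ((⋃ i ∈ I, Metric.closedBall (c n i) t') ∩
      Metric.closedBall (X n).basepoint ρ')) := by
  have h1 : L.Nb (fun n => ⋃ i ∈ I, Metric.ball (c n i) t')
      (⋃ i ∈ I, Metric.closedBall (y i) ((t+t')/2)) := by
    intro z hz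
    simp only [Set.mem_iUnion] at hz
    obtain ⟨i, hi, hzi⟩ := hz
    refine (nb_ball (hcy i) (show (t+t')/2 < t' by linarith)).mono ?_ le_rfl z hzi
    intro n
    exact Set.subset_biUnion_of_mem (u := fun i => Metric.ball (c n i) t') hi
  have h2 : L.Nb (fun n => Metric.ball (X n).basepoint ρ') (Metric.closedBall L.o ((ρ+ρ')/2)) :=
    nb_ball L.tendsto_base (by linarith)
  have h3 := (h1.mono (fun _ => le_rfl) Set.inter_subset_left).inter
    (h2.mono (fun _ => le_rfl) Set.inter_subset_right)
  refine (nu_le hm ((net_compact hX I _).inter_right Metric.isClosed_closedBall) ?_ ?_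
    h3).trans (ulim_mono (Eventually.of_forall fun n => measure_mono ?_))
  · rw [interior_inter]
    refine Set.inter_subset_inter ?_ ?_
    · intro z hz
      simp only [Set.mem_iUnion] at hz
      obtain ⟨i, hi, hzi⟩ := hz
      refine interior_mono (Set.subset_biUnion_of_mem
        (u := fun i => Metric.closedBall (y i) ((t+t')/2)) hi) ?_
      exact Metric.ball_subset_interior_closedBall
        (Metric.closedBall_subset_ball (by linarith) hzi)
    · exact (Metric.closedBall_subset_ball (by linarith)).trans
        Metric.ball_subset_interior_closedBall
  · intro n
    exact ((isOpen_biUnion fun z _ => Metric.isOpen_ball).inter Metric.isOpen_ball).measurableSet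
  · exact Set.inter_subset_inter (Set.iUnion₂_mono fun i _ => Metric.ball_subset_closedBall)
      Metric.ball_subset_closedBall

theorem exists_net (L : ULim X) (hX : UnifSmall X) {r ε : ℝ} (hr : 0 ≤ r) (hε : 0 < ε) :
    ∃ (N : ℕ) (c : ∀ n, Option (Fin N) → (X n).carrier) (y : Option (Fin N) → L.Y),
      (∀ n, c n none = (X n).basepoint) ∧ y none = L.o ∧
      (∀ n i, c n i ∈ Metric.closedBall (X n).basepoint r) ∧
      (∀ i, Tendsto (fun n => dist (c n i) (L.rep (y i) n)) UF (𝓝 0)) ∧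
      (∀ n, ∀ x ∈ Metric.closedBall (X n).basepoint r, ∃ i, dist x (c n i) ≤ ε) ∧
      (∀ᶠ n in UF, ∀ i j, |dist (c n i) (c n j) - dist (y i) (y j)| ≤ 2 * ε) ∧
      (∀ (x : ∀ n, (X n).carrier) (b : L.Y),
        (∀ᶠ n in UF, x n ∈ Metric.closedBall (X n).basepoint r) →
        Tendsto (fun n => dist (x n) (L.rep b n)) UF (𝓝 0) → ∃ i, dist b (y i) ≤ ε) := by
  obtain ⟨N, hN⟩ := hX r ε hr hε
  choose p hp using fun n => (hN n).1
  have hc : ∀ n, ∀ i : Fin N, ∃ c ∈ Metric.closedBall (X n).basepoint r,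
      ∀ x ∈ Metric.closedBall (X n).basepoint r, p n x = i → dist x c ≤ ε := by
    intro n i
    by_cases h : ∃ c ∈ Metric.closedBall (X n).basepoint r, p n c = i
    · obtain ⟨c, hc, hci⟩ := h
      exact ⟨c, hc, fun x hx hxi => hp n x hx c hc (by rw [hxi, hci])⟩
    · push Not at h
      exact ⟨(X n).basepoint, Metric.mem_closedBall_self hr, fun x hx hxi => absurd hxi (h x hx)⟩
  choose c hc1 hc2 using hc
  have hy : ∀ i : Fin N, ∃ y : L.Y, Tendsto (fun n => dist (c n i) (L.rep y n)) UF (𝓝 0) :=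
    fun i => L.exists_lim (fun n => c n i) r (Eventually.of_forall fun n => hc1 n i)
  choose y hy using hy
  let c' : ∀ n, Option (Fin N) → (X n).carrier := fun n i => i.elim (X n).basepoint (c n)
  let y' : Option (Fin N) → L.Y := fun i => i.elim L.o y
  have hcy : ∀ i, Tendsto (fun n => dist (c' n i) (L.rep (y' i) n)) UF (𝓝 0) := by
    rintro (_ | i)
    · exact L.tendsto_base
    · exact hy i
  refine ⟨N, c', y', fun _ => rfl, rfl, ?_, hcy, ?_, ?_, ?_⟩
  · rintro n (_ | i)
    · exact Metric.mem_closedBall_self hr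
    · exact hc1 n i
  · intro n x hx
    exact ⟨some (p n x), hc2 n _ x hx rfl⟩
  · rw [Filter.eventually_all]
    intro i
    rw [Filter.eventually_all]
    intro j
    have h1 := L.tendsto_dist_of (hcy i) (hcy j)
    have h2 := (Metric.tendsto_nhds.1 h1) (2 * ε) (by linarith)
    filter_upwards [h2] with n hn
    rw [Real.dist_eq] at hn
    exact hn.le
  · intro x b hx hb
    obtain ⟨i, hi⟩ := UF_pigeonhole (fun n => p n (x n))
    refine ⟨some i, le_of_tendsto (L.tendsto_dist_of hb (hcy (some i))) ?_⟩
    filter_upwards [hi, hx] with n h1 h2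
    exact hc2 n i (x n) h2 h1

end ULim


theorem measure_le_inter_of_supp {α : Type*} [MeasurableSpace α] (μ : Measure α) {K C : Set α}
    (h : μ Kᶜ = 0) (hKC : K ⊆ C) (A : Set α) : μ A ≤ μ (A ∩ C) := by
  calc μ A ≤ μ ((A ∩ C) ∪ Kᶜ) := measure_mono fun x hx => by
        by_cases hxK : x ∈ K
        · exact Or.inl ⟨hx, hKC hxK⟩
        · exact Or.inr hxK
    _ ≤ μ (A ∩ C) + μ Kᶜ := measure_union_le _ _
    _ = _ := by rw [h, add_zero]

namespace ULim
variable {X : ℕ → PMM}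

/-- The limit of the closed balls of radius `r`. -/
def Kr (L : ULim X) (r : ℝ) : Set L.Y :=
  {y | ∀ s > 0, ∀ᶠ n in UF, ∃ x ∈ Metric.closedBall (X n).basepoint r, dist (L.rep y n) x < s}

variable {L : ULim X}

theorem mem_Kr_of_tendsto {r : ℝ} {x : ∀ n, (X n).carrier} {y : L.Y}
    (hx : ∀ᶠ n in UF, x n ∈ Metric.closedBall (X n).basepoint r)
    (h : Tendsto (fun n => dist (x n) (L.rep y n)) UF (𝓝 0)) : y ∈ L.Kr r := by
  intro s hs
  filter_upwards [hx, h.eventually_lt_const hs] with n h1 h2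
  exact ⟨x n, h1, by rwa [dist_comm]⟩

theorem o_mem_Kr {r : ℝ} (hr : 0 ≤ r) : L.o ∈ L.Kr r :=
  mem_Kr_of_tendsto (Eventually.of_forall fun n => Metric.mem_closedBall_self hr) L.tendsto_base

theorem Kr_seq {r : ℝ} (hr : 0 ≤ r) {b : L.Y} (hb : b ∈ L.Kr r) {s : ℝ} (hs : 0 < s) :
    ∃ (x : ∀ n, (X n).carrier) (b' : L.Y), (∀ n, x n ∈ Metric.closedBall (X n).basepoint r) ∧
      Tendsto (fun n => dist (x n) (L.rep b' n)) UF (𝓝 0) ∧ dist b b' ≤ s := by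
  classical
  let x : ∀ n, (X n).carrier := fun n =>
    if h : ∃ x ∈ Metric.closedBall (X n).basepoint r, dist (L.rep b n) x < s then h.choose
    else (X n).basepoint
  have hx1 : ∀ n, x n ∈ Metric.closedBall (X n).basepoint r := by
    intro n
    by_cases h : ∃ x ∈ Metric.closedBall (X n).basepoint r, dist (L.rep b n) x < s
    · simp only [x, dif_pos h]
      exact h.choose_spec.1
    · simp only [x, dif_neg h]
      exact Metric.mem_closedBall_self hr
  have hx2 : ∀ᶠ n in UF, dist (L.rep b n) (x n) ≤ s := by
    filter_upwards [hb s hs] with n h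
    simp only [x, dif_pos h]
    exact h.choose_spec.2.le
  obtain ⟨b', hb'⟩ := L.exists_lim x r (Eventually.of_forall hx1)
  exact ⟨x, b', hx1, hb', le_of_tendsto (L.tendsto_dist_of (L.tendsto_rep b) hb') hx2⟩

theorem isClosed_Kr (r : ℝ) : IsClosed (L.Kr r) := by
  refine isClosed_of_closure_subset fun y hy s hs => ?_
  obtain ⟨z, hz, hyz⟩ := Metric.mem_closure_iff.1 hy (s/2) (half_pos hs)
  filter_upwards [hz (s/2) (half_pos hs), (L.tendsto_dist y z).eventually_lt_const hyz] with n h1 h2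
  obtain ⟨x, hx, hzx⟩ := h1
  refine ⟨x, hx, ?_⟩
  have := dist_triangle (L.rep y n) (L.rep z n) x
  linarith

theorem Kr_subset (r : ℝ) : L.Kr r ⊆ Metric.closedBall L.o r := by
  intro y hy
  rw [Metric.mem_closedBall]
  refine le_of_forall_pos_le_add fun s hs => ?_
  refine le_of_tendsto (L.tendsto_dist_of (L.tendsto_rep y) L.tendsto_base) ?_
  filter_upwards [hy s hs] with n hn
  obtain ⟨x, hx, hyx⟩ := hn
  have := dist_triangle (L.rep y n) x (X n).basepoint
  rw [Metric.mem_closedBall] at hx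
  linarith

theorem ball_subset_Kr (r : ℝ) : Metric.ball L.o r ⊆ L.Kr r := by
  intro y hy
  exact mem_Kr_of_tendsto ((L.rep_bdd y hy).mono fun n hn => hn.le) (L.tendsto_rep y)

theorem isCompact_Kr (hX : UnifSmall X) (r : ℝ) : IsCompact (L.Kr r) :=
  (L.isCompact_closedBall hX L.o r).of_isClosed_subset (isClosed_Kr r) (Kr_subset r)

theorem nu_Kr_compl (hX : UnifSmall X) {r : ℝ} (hr : 0 ≤ r) :
    L.nu (unifFin_ball hX r) (L.Kr r)ᶜ = 0 := by
  refine nu_eq_zero _ (isClosed_Kr r).isOpen_compl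
    (A := fun n => (Metric.closedBall (X n).basepoint r)ᶜ)
    (fun n => measurableSet_closedBall.compl) ?_ ?_
  · intro y hy
    have hy' : ¬ (∀ s > 0, ∀ᶠ n in UF,
      ∃ x ∈ Metric.closedBall (X n).basepoint r, dist (L.rep y n) x < s) := hy
    push Not at hy'
    obtain ⟨s, hs, h⟩ := hy'
    refine ⟨s, hs, ?_⟩
    filter_upwards [h] with n hn x hx hxr
    have h1 := hn x hxr
    rw [Metric.mem_ball, dist_comm] at hx
    exact absurd hx (not_lt.2 h1)
  · intro n
    have := ((X n).ballSub r).supported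
    rwa [(X n).ballSub_set hr] at this

/-- The limit of closed balls as a sub-pmm of the limit. -/
def limSub (L : ULim X) (hX : UnifSmall X) {r : ℝ} (hr : 0 ≤ r) :
    SubPMM (L.pmm (unifFin_meas hX)) where
  set := L.Kr r
  root_mem := o_mem_Kr hr
  meas := L.nu (unifFin_ball hX r)
  meas_le := by
    refine Measure.le_iff.2 fun E hE => ?_
    refine nu_mono_on (unifFin_ball hX r) (unifFin_meas hX) isOpen_univ ?_ hE (Set.subset_univ _)
    intro K _ _
    exact le_lam fun A hA hAK => (lam_le _ hA hAK).trans
      (ulim_mono (Eventually.of_forall fun n => ((X n).ballSub r).meas_le _))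
  supported := nu_Kr_compl hX hr

theorem limSub_compact (hX : UnifSmall X) {r : ℝ} (hr : 0 ≤ r) :
    (L.limSub hX hr).IsCompactSub := by
  refine ⟨isCompact_Kr hX r, ?_⟩
  refine ne_top_of_le_ne_top (nu_closedBall_ne_top hX (unifFin_ball hX r) L.o r) ?_
  refine (measure_le_inter_of_supp _ (nu_Kr_compl hX hr) (Kr_subset r) _).trans ?_
  exact measure_mono Set.inter_subset_right

theorem ballSub_le_limSub (hX : UnifSmall X) {r t : ℝ} (hr : 0 < r) (ht : t < r) :
    (L.pmm (unifFin_meas hX)).ballSub t ≤ L.limSub hX hr.le := by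
  have hsub : insert L.o (Metric.closedBall L.o t) ⊆ Metric.ball L.o r := by
    rintro y (rfl | hy)
    · exact Metric.mem_ball_self hr
    · exact lt_of_le_of_lt hy ht
  refine ⟨hsub.trans (ball_subset_Kr r), ?_⟩
  refine Measure.le_iff.2 fun E hE => ?_
  change (L.nu (unifFin_meas hX)).restrict (insert L.o (Metric.closedBall L.o t)) E ≤
    L.nu (unifFin_ball hX r) E
  rw [Measure.restrict_apply hE]
  refine le_trans ?_ (measure_mono (Set.inter_subset_left
    (t := insert L.o (Metric.closedBall L.o t))))
  refine nu_mono_on (unifFin_meas hX) (unifFin_ball hX r) (Metric.isOpen_ball (x := L.o) (ε := r))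
    ?_ ?_ (Set.inter_subset_right.trans hsub)
  · intro K hK _
    refine le_lam fun A hA hAK => ?_
    have hB : L.Nb (fun n => Metric.closedBall (X n).basepoint r) K := by
      intro y hy
      have hy' : dist y L.o < r := hK hy
      have := nb_ball L.tendsto_base hy' (t := dist y L.o) y (Metric.mem_closedBall.2 le_rfl)
      obtain ⟨s, hs, h⟩ := this
      exact ⟨s, hs, h.mono fun n hn => hn.trans Metric.ball_subset_closedBall⟩
    refine (lam_le _ (fun n => (hA n).inter measurableSet_closedBall) (hAK.inter hB)).trans
      (ulim_mono (Eventually.of_forall fun n => ?_))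
    simp only [(X n).ballSub_meas hr.le]
    rw [Measure.restrict_apply (hA n)]
  · exact hE.inter (measurableSet_closedBall.insert _)

theorem app1 (hX : UnifSmall X) (hb : ∀ n, (X n).BoundedlyCompact) {r : ℝ} (hr : 0 ≤ r) {ε : ℝ}
    (hε : 0 < ε) :
    ∀ᶠ n in UF, cGHP ((X n).ballSub r).toPMM (L.limSub hX hr).toPMM ≤ 5 * ε := by
  obtain ⟨N, c, y, hc0, hy0, hcr, hcy, hcov, hd, hlim⟩ := L.exists_net hX hr (half_pos hε)
  have hm : ∀ᶠ n in UF, ∀ I : Set (Option (Fin N)),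
      ((X n).ballSub r).meas (⋃ i ∈ I, Metric.closedBall (c n i) ε) ≤
      L.nu (unifFin_ball hX r) (⋃ i ∈ I, Metric.closedBall (y i) (3 * ε)) + ENNReal.ofReal ε := by
    rw [Filter.eventually_all]
    intro I
    have h1 := eventually_le_of_ulim_le hε
      (measure_ne_top_of_subset Set.inter_subset_right
        (nu_closedBall_ne_top hX (unifFin_ball hX r) L.o r))
      (net_ulim_le hcy hX (unifFin_ball hX r) I ε r)
    filter_upwards [h1] with n hn
    refine (measure_le_inter_of_supp _ ((X n).ballSub r).supported
      ((X n).ballSub_set hr).le _).trans (hn.trans ?_)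
    gcongr
    refine Set.inter_subset_left.trans (Set.iUnion₂_mono fun i _ => ?_)
    exact Metric.closedBall_subset_closedBall (by linarith)
  have hm' : ∀ᶠ n in UF, ∀ I : Set (Option (Fin N)),
      L.nu (unifFin_ball hX r) (⋃ i ∈ I, Metric.closedBall (y i) ε) ≤
      ((X n).ballSub r).meas (⋃ i ∈ I, Metric.closedBall (c n i) (3 * ε)) + ENNReal.ofReal ε := by
    rw [Filter.eventually_all]
    intro I
    have h1 := eventually_le_of_le_ulim hε
      (measure_ne_top_of_subset Set.inter_subset_right
        (nu_closedBall_ne_top hX (unifFin_ball hX r) L.o r))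
      (net_le_ulim hcy hX (unifFin_ball hX r) I (show ε < 3 * ε by linarith) (lt_add_one r))
    filter_upwards [h1] with n hn
    refine (measure_le_inter_of_supp _ (nu_Kr_compl hX hr) (Kr_subset r) _).trans (hn.trans ?_)
    gcongr
    exact Set.inter_subset_left
  filter_upwards [hd, hm, hm'] with n hd hm hm'
  refine cGHP_le_of_net _ _ ((X n).ballSub_compact (hb n) r).1 (limSub_compact hX hr).1 none
    (c n) y hε (hc0 n) hy0 (fun i j => (hd i j).trans (by linarith)) ?_ ?_ hm hm'
  · intro a ha
    rw [(X n).ballSub_set hr] at ha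
    obtain ⟨i, hi⟩ := hcov n a ha
    refine ⟨i, hi.trans (by linarith), y i, ?_, ?_⟩
    · exact mem_Kr_of_tendsto (Eventually.of_forall fun n => hcr n i) (hcy i)
    · exact (dist_self (y i)).le.trans (by linarith)
  · intro b hb
    obtain ⟨x, b', hx, hb', hbb'⟩ := Kr_seq hr hb (half_pos hε)
    obtain ⟨i, hi⟩ := hlim x b' (Eventually.of_forall hx) hb'
    refine ⟨i, ?_, c n i, ?_, by rw [dist_self]; linarith⟩
    · exact (dist_triangle b b' (y i)).trans (by linarith)
    · rw [(X n).ballSub_set hr]; exact hcr n i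

theorem exists_eta (hX : UnifSmall X) {m : ∀ n, Measure (X n).carrier} (hm : UnifFin m)
    {r ε : ℝ} (hε : 0 < ε) :
    ∃ η > 0, η ≤ ε ∧
      Metric.closedBall L.o (r + η) ⊆ Metric.thickening ε (Metric.closedBall L.o r) ∧
      L.nu hm (Metric.closedBall L.o (r + η)) ≤
        L.nu hm (Metric.closedBall L.o r) + ENNReal.ofReal (ε / 2) := by
  let s : ℕ → Set L.Y := fun k => Metric.closedBall L.o (r + 1 / ((k : ℝ) + 1))
  have hs : Antitone s := fun j k hjk => Metric.closedBall_subset_closedBall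
    (by gcongr)
  have hcap : ⋂ k, s k = Metric.closedBall L.o r := by
    ext y
    simp only [Set.mem_iInter, s, Metric.mem_closedBall]
    constructor
    · intro h
      have h1 : Tendsto (fun k : ℕ => r + 1 / ((k : ℝ) + 1)) atTop (𝓝 (r + 0)) :=
        tendsto_const_nhds.add tendsto_one_div_add_atTop_nhds_zero_nat
      rw [add_zero] at h1
      exact ge_of_tendsto' h1 h
    · intro h k
      have : 0 < 1 / ((k : ℝ) + 1) := by positivity
      linarith
  have h1 : ∀ᶠ k in atTop, s k ⊆ Metric.thickening ε (Metric.closedBall L.o r) := by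
    obtain ⟨k, hk⟩ := exists_subset_nhds_of_isCompact' (V := s) (directed_of_isDirected_le hs)
      (fun k => L.isCompact_closedBall hX _ _) (fun k => Metric.isClosed_closedBall)
      (U := Metric.thickening ε (Metric.closedBall L.o r)) (fun x hx => by
        rw [hcap] at hx
        exact Metric.isOpen_thickening.mem_nhds (Metric.self_subset_thickening hε _ hx))
    filter_upwards [eventually_ge_atTop k] with j hj
    exact (hs hj).trans hk
  have h2 : ∀ᶠ k in atTop, L.nu hm (s k) ≤
      L.nu hm (Metric.closedBall L.o r) + ENNReal.ofReal (ε / 2) := by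
    have := tendsto_measure_iInter_atTop (μ := L.nu hm) (s := s)
      (fun k => measurableSet_closedBall.nullMeasurableSet) hs
      ⟨0, nu_closedBall_ne_top hX hm _ _⟩
    rw [hcap] at this
    exact (this.eventually_lt_const (ENNReal.lt_add_right (nu_closedBall_ne_top hX hm _ _)
      (ENNReal.ofReal_pos.2 (half_pos hε)).ne')).mono fun k hk => hk.le
  have h3 : ∀ᶠ k : ℕ in atTop, 1 / ((k : ℝ) + 1) < ε :=
    (tendsto_one_div_add_atTop_nhds_zero_nat (𝕜 := ℝ)).eventually_lt_const hε
  obtain ⟨k, h1, h2, h3⟩ := (h1.and (h2.and h3)).exists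
  exact ⟨1 / ((k : ℝ) + 1), by positivity, h3.le, h1, h2⟩

theorem app2 (hX : UnifSmall X) (hb : ∀ n, (X n).BoundedlyCompact) {r : ℝ} (hr : 0 ≤ r) {ε : ℝ}
    (hε : 0 < ε) :
    ∃ η > 0, ∀ᶠ n in UF, cGHP ((L.pmm (unifFin_meas hX)).ballSub r).toPMM
      ((X n).ballSub (r + η)).toPMM ≤ 5 * ε := by
  obtain ⟨η, hη, hηε, hth, hnu⟩ := exists_eta (L := L) hX (unifFin_meas hX) (r := r) hε
  refine ⟨η, hη, ?_⟩
  have hr' : 0 ≤ r + η := by linarith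
  have hfin := fun ρ => nu_closedBall_ne_top hX (unifFin_meas hX) L.o ρ
  have hpb : (L.pmm (unifFin_meas hX)).BoundedlyCompact := pmm_boundedlyCompact hX _
  obtain ⟨N, c, y, hc0, hy0, hcr, hcy, hcov, hd, hlim⟩ := L.exists_net hX hr' (half_pos hε)
  have hm : ∀ᶠ n in UF, ∀ I : Set (Option (Fin N)),
      ((L.pmm (unifFin_meas hX)).ballSub r).meas (⋃ i ∈ I, Metric.closedBall (y i) ε) ≤
      ((X n).ballSub (r + η)).meas (⋃ i ∈ I, Metric.closedBall (c n i) (3 * ε)) +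
        ENNReal.ofReal ε := by
    rw [Filter.eventually_all]
    intro I
    have h1 := eventually_le_of_le_ulim hε
      (measure_ne_top_of_subset Set.inter_subset_right (hfin r))
      (net_le_ulim hcy hX (unifFin_meas hX) I (show ε < 3 * ε by linarith)
        (show r < r + η by linarith))
    filter_upwards [h1] with n hn
    rw [PMM.ballSub_meas _ hr, PMM.ballSub_meas _ hr',
      Measure.restrict_apply' measurableSet_closedBall,
      Measure.restrict_apply' measurableSet_closedBall]
    exact hn
  have hm' : ∀ᶠ n in UF, ∀ I : Set (Option (Fin N)),
      ((X n).ballSub (r + η)).meas (⋃ i ∈ I, Metric.closedBall (c n i) ε) ≤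
      ((L.pmm (unifFin_meas hX)).ballSub r).meas (⋃ i ∈ I, Metric.closedBall (y i) (3 * ε)) +
        ENNReal.ofReal ε := by
    rw [Filter.eventually_all]
    intro I
    have h1 := eventually_le_of_ulim_le (half_pos hε)
      (measure_ne_top_of_subset Set.inter_subset_right (hfin (r + η)))
      (net_ulim_le hcy hX (unifFin_meas hX) I ε (r + η))
    filter_upwards [h1] with n hn
    rw [PMM.ballSub_meas _ hr, PMM.ballSub_meas _ hr',
      Measure.restrict_apply' measurableSet_closedBall,
      Measure.restrict_apply' measurableSet_closedBall]
    refine hn.trans ?_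
    have hdiff : L.nu (unifFin_meas hX) (Metric.closedBall L.o (r + η) \ Metric.closedBall L.o r)
        ≤ ENNReal.ofReal (ε / 2) := by
      rw [measure_sdiff (Metric.closedBall_subset_closedBall (by linarith))
        measurableSet_closedBall.nullMeasurableSet (hfin r)]
      exact tsub_le_iff_left.2 hnu
    have hsplit : L.nu (unifFin_meas hX) ((⋃ i ∈ I, Metric.closedBall (y i) ε) ∩
        Metric.closedBall L.o (r + η)) ≤ L.nu (unifFin_meas hX)
          ((⋃ i ∈ I, Metric.closedBall (y i) (3 * ε)) ∩ Metric.closedBall L.o r) +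
          ENNReal.ofReal (ε / 2) := by
      refine (measure_mono ?_).trans ((measure_union_le _ _).trans (add_le_add le_rfl hdiff))
      rintro z ⟨hz1, hz2⟩
      by_cases hz : z ∈ Metric.closedBall L.o r
      · refine Or.inl ⟨?_, hz⟩
        exact (Set.iUnion₂_mono fun i _ =>
          Metric.closedBall_subset_closedBall (show ε ≤ 3 * ε by linarith)) hz1
      · exact Or.inr ⟨hz2, hz⟩
    refine (add_le_add hsplit le_rfl).trans ?_
    rw [add_assoc, ← ENNReal.ofReal_add (by linarith) (by linarith), add_halves]
  filter_upwards [hd, hm, hm'] with n hd hm hm'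
  refine cGHP_le_of_net _ _ ((L.pmm _).ballSub_compact hpb r).1
    ((X n).ballSub_compact (hb n) (r + η)).1 none
    y (c n) hε hy0 (hc0 n) (fun i j => ?_) ?_ ?_ hm hm'
  · rw [abs_sub_comm]
    exact (hd i j).trans (by linarith)
  · intro a ha
    rw [PMM.ballSub_set _ hr] at ha
    obtain ⟨i, hi⟩ := hlim (L.rep a) a
      ((L.rep_bdd a (lt_of_le_of_lt ha (show r < r + η by linarith))).mono fun n hn => hn.le)
      (L.tendsto_rep a)
    refine ⟨i, hi.trans (by linarith), c n i, ?_, by rw [dist_self]; linarith⟩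
    rw [(X n).ballSub_set hr']; exact hcr n i
  · intro b hb
    rw [PMM.ballSub_set _ hr'] at hb
    obtain ⟨i, hi⟩ := hcov n b hb
    have hyi : y i ∈ Metric.closedBall L.o (r + η) :=
      Kr_subset _ (mem_Kr_of_tendsto (Eventually.of_forall fun n => hcr n i) (hcy i))
    obtain ⟨a, ha, hya⟩ := Metric.mem_thickening_iff.1 (hth hyi)
    refine ⟨i, hi.trans (by linarith), a, ?_, hya.le.trans (by linarith)⟩
    rw [PMM.ballSub_set _ hr]; exact ha

end ULim


theorem aEps_le {ε : ℝ} {𝒳 𝒴 : PMM} (Y' : SubPMM 𝒴) (h1 : Y'.IsCompactSub)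
    (h2 : 𝒴.ballSub (1 / ε - ε) ≤ Y') :
    aEps ε 𝒳 𝒴 ≤ cGHP ((𝒳.ballSub (1 / ε)).toPMM) Y'.toPMM := by
  refine csInf_le ⟨0, ?_⟩ ⟨Y', h1, h2, rfl⟩
  rintro x ⟨_, _, _, rfl⟩
  exact cGHP_nonneg _ _

theorem exists_of_aEps_lt {ε a : ℝ} {𝒳 𝒴 : PMM} (hY : 𝒴.BoundedlyCompact)
    (h : aEps ε 𝒳 𝒴 < a) : ∃ Y' : SubPMM 𝒴, Y'.IsCompactSub ∧
      cGHP ((𝒳.ballSub (1 / ε)).toPMM) Y'.toPMM < a := by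
  have hne : {x : ℝ | ∃ Y' : SubPMM 𝒴, Y'.IsCompactSub ∧ 𝒴.ballSub (1 / ε - ε) ≤ Y' ∧
    x = cGHP ((𝒳.ballSub (1 / ε)).toPMM) Y'.toPMM}.Nonempty :=
    ⟨_, 𝒴.ballSub (1 / ε - ε), PMM.ballSub_compact hY _, PMM.ballSub_mono _ le_rfl, rfl⟩
  obtain ⟨x, ⟨Y', h1, h2, rfl⟩, hx⟩ := exists_lt_of_csInf_lt hne h
  exact ⟨Y', h1, hx⟩

theorem GHP_bdd (𝒳 𝒴 : PMM) : ∀ x ∈ insert (1 : ℝ) {ε : ℝ | ε ∈ Set.Ioc (0 : ℝ) 1 ∧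
    max (aEps ε 𝒳 𝒴) (aEps ε 𝒴 𝒳) < ε / 2}, 0 ≤ x := by
  rintro x (rfl | hx)
  · exact zero_le_one
  · exact hx.1.1.le

theorem GHP_nonneg (𝒳 𝒴 : PMM) : 0 ≤ GHP 𝒳 𝒴 := Real.sInf_nonneg (GHP_bdd 𝒳 𝒴)

theorem exists_of_GHP_lt {𝒳 𝒴 : PMM} (hY : 𝒴.BoundedlyCompact) {a : ℝ} (ha : a ≤ 1)
    (h : GHP 𝒳 𝒴 < a) : ∃ δ, 0 < δ ∧ δ < a ∧ ∃ Y' : SubPMM 𝒴, Y'.IsCompactSub ∧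
      cGHP ((𝒳.ballSub (1 / δ)).toPMM) Y'.toPMM < δ / 2 := by
  obtain ⟨δ, hδ, hδa⟩ := exists_lt_of_csInf_lt ⟨1, Set.mem_insert _ _⟩ h
  rcases hδ with rfl | hδ
  · exact absurd hδa (not_lt.2 ha)
  · exact ⟨δ, hδ.1.1, hδa, exists_of_aEps_lt hY ((le_max_left _ _).trans_lt hδ.2)⟩

theorem ULim.eventually_GHP_le {X : ℕ → PMM} (L : ULim X) (hX : UnifSmall X)
    (hb : ∀ n, (X n).BoundedlyCompact) {ε : ℝ} (hε : 0 < ε) (hε1 : ε ≤ 1) :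
    ∀ᶠ n in UF, GHP (X n) (L.pmm (unifFin_meas hX)) ≤ ε := by
  have hr : 0 < 1 / ε := by positivity
  have hε0 : 0 < ε / 20 := by positivity
  obtain ⟨η, hη, h2⟩ := ULim.app2 (L := L) hX hb hr.le hε0
  filter_upwards [ULim.app1 (L := L) hX hb hr.le hε0, h2] with n h1 h2
  refine csInf_le ⟨0, GHP_bdd _ _⟩ (Or.inr ⟨⟨hε, hε1⟩, max_lt ?_ ?_⟩)
  · refine ((aEps_le (L.limSub hX hr.le) (ULim.limSub_compact hX hr.le)
      (ULim.ballSub_le_limSub hX hr (by linarith))).trans h1).trans_lt (by linarith)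
  · refine ((aEps_le ((X n).ballSub (1 / ε + η)) (PMM.ballSub_compact (hb n) _)
      (PMM.ballSub_mono _ (by linarith))).trans h2).trans_lt (by linarith)

theorem UF_extract {u : ℕ → ℝ} (h0 : ∀ n, 0 ≤ u n)
    (h : ∀ ε : ℝ, 0 < ε → ε ≤ 1 → ∀ᶠ n in UF, u n ≤ ε) :
    ∃ φ : ℕ → ℕ, StrictMono φ ∧ Tendsto (fun n => u (φ n)) atTop (𝓝 0) := by
  have h1 : ∀ k : ℕ, ∃ᶠ n in atTop, u n ≤ 1 / ((k : ℝ) + 1) := fun k =>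
    UF_frequently (h _ (by positivity) (by
      rw [div_le_one (by positivity)]; linarith [(Nat.cast_nonneg k : (0 : ℝ) ≤ k)]))
  obtain ⟨φ, hφ, h2⟩ := Filter.extraction_forall_of_frequently h1
  exact ⟨φ, hφ, squeeze_zero (fun n => h0 _) h2 tendsto_one_div_add_atTop_nhds_zero_nat⟩

/-- Uniform smallness of a family. -/
def FamSmall (𝒞 : Set PMM) : Prop :=
  ∀ r ε : ℝ, 0 ≤ r → 0 < ε → ∃ N : ℕ, ∀ 𝒳 ∈ 𝒞,
    NetSmall N ε (Metric.closedBall 𝒳.basepoint r) ∧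
      𝒳.meas (Metric.closedBall 𝒳.basepoint r) ≤ N

theorem famSmall_of_seq {𝒞 : Set PMM}
    (h : ∀ r ε : ℝ, 0 ≤ r → 0 < ε → ∀ X : ℕ → PMM, (∀ n, X n ∈ 𝒞) →
      ∃ (φ : ℕ → ℕ) (M : ℕ), StrictMono φ ∧ ∀ᶠ k in atTop,
        NetSmall M ε (Metric.closedBall (X (φ k)).basepoint r) ∧
        (X (φ k)).meas (Metric.closedBall (X (φ k)).basepoint r) ≤ M) : FamSmall 𝒞 := by
  intro r ε hr hε
  by_contra hcon
  push Not at hcon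
  choose X hX hX' using hcon
  obtain ⟨φ, M, hφ, hk⟩ := h r ε hr hε X hX
  obtain ⟨k, ⟨h1, h2⟩, hk⟩ := (hk.and (eventually_ge_atTop M)).exists
  have hM : M ≤ φ k := hk.trans (hφ.id_le k)
  refine absurd (hX' (φ k) (h1.mono le_rfl hM)) (not_lt.2 (h2.trans ?_))
  exact_mod_cast hM

theorem NetSmall.mono_eps {α : Type*} [MetricSpace α] {N : ℕ} {ε ε' : ℝ} {s : Set α}
    (h : NetSmall N ε s) (hε : ε ≤ ε') : NetSmall N ε' s := by
  obtain ⟨p, hp⟩ := h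
  exact ⟨p, fun x hx y hy hxy => (hp x hx y hy hxy).trans hε⟩

theorem small_transfer {𝒳 : PMM} {r R ε : ℝ} {N : ℕ} {a : ENNReal} (hr : 0 ≤ r) (hrR : r ≤ R)
    (h : NetSmall N ε (Metric.closedBall (𝒳.ballSub R).toPMM.basepoint r) ∧
      (𝒳.ballSub R).toPMM.meas (Metric.closedBall (𝒳.ballSub R).toPMM.basepoint r) ≤ a) :
    NetSmall N ε (Metric.closedBall 𝒳.basepoint r) ∧
      𝒳.meas (Metric.closedBall 𝒳.basepoint r) ≤ a := by
  classical
  have hR : 0 ≤ R := hr.trans hrR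
  have hsub : Metric.closedBall 𝒳.basepoint r ⊆ (𝒳.ballSub R).set := by
    rw [𝒳.ballSub_set hR]; exact Metric.closedBall_subset_closedBall hrR
  constructor
  · obtain ⟨p, hp⟩ := h.1
    refine ⟨fun x => if hx : x ∈ (𝒳.ballSub R).set then p ⟨x, hx⟩ else
      p (𝒳.ballSub R).toPMM.basepoint, fun x hx y hy hxy => ?_⟩
    simp only [dif_pos (hsub hx), dif_pos (hsub hy)] at hxy
    exact hp ⟨x, hsub hx⟩ hx ⟨y, hsub hy⟩ hy hxy
  · have hms : MeasurableSet (𝒳.ballSub R).set := by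
      rw [𝒳.ballSub_set hR]; exact measurableSet_closedBall
    have h1 := (𝒳.ballSub R).toPMM_meas_preimage hms
      (measurableSet_closedBall (x := 𝒳.basepoint) (ε := r))
    have h2 : (𝒳.ballSub R).toPMM.meas
      (Metric.closedBall (𝒳.ballSub R).toPMM.basepoint r) = _ := h1
    rw [𝒳.ballSub_meas hR, Measure.restrict_apply measurableSet_closedBall,
      Set.inter_eq_left.2 (Metric.closedBall_subset_closedBall hrR)] at h2
    rw [← h2]
    exact h.2

theorem exists_nat_ge_ennreal {a : ENNReal} (h : a ≠ ⊤) : ∃ N : ℕ, a ≤ N :=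
  (ENNReal.exists_nat_gt h).imp fun _ h => h.le

theorem famSmall_of_cGHP {𝒞 : Set PMM} (h𝒞 : ∀ 𝒳 ∈ 𝒞, PMM.BoundedlyCompact 𝒳)
    (h : ∀ r : ℝ, 0 ≤ r → ∀ 𝒳 : ℕ → PMM, (∀ n, 𝒳 n ∈ 𝒞) →
      ∃ (φ : ℕ → ℕ) (𝒴 : PMM), StrictMono φ ∧ 𝒴.IsCompactPMM ∧
        Tendsto (fun n => cGHP (((𝒳 (φ n)).ballSub r).toPMM) 𝒴) atTop (𝓝 0)) :
    FamSmall 𝒞 := by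
  refine famSmall_of_seq fun r ε hr hε X hX => ?_
  obtain ⟨φ, 𝒴, hφ, hY, ht⟩ := h r hr X hX
  have hδ : 0 < ε / 4 := by linarith
  obtain ⟨N, hN⟩ := (@isCompact_univ _ _ hY.1).small (half_pos hε)
  obtain ⟨N', hN'⟩ := exists_nat_ge_ennreal
    (ENNReal.add_ne_top.2 ⟨hY.2, (ENNReal.ofReal_ne_top (r := ε / 4))⟩)
  refine ⟨φ, max N N', hφ, ?_⟩
  filter_upwards [ht.eventually_lt_const hδ] with k hk
  have h1 := small_of_cGHP_lt (PMM.ballSub_compact (h𝒞 _ (hX _)) r).isCompactPMM hY hk (r := r)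
    (hN.mono (Set.subset_univ _) le_rfl)
  have h2 := small_transfer hr le_rfl h1
  refine ⟨(h2.1.mono le_rfl (le_max_left _ _)).mono_eps (by linarith), h2.2.trans ?_⟩
  refine (add_le_add (measure_mono (Set.subset_univ _)) le_rfl).trans (hN'.trans ?_)
  exact_mod_cast le_max_right _ _

theorem famSmall_of_GHP {𝒞 : Set PMM} (h𝒞 : ∀ 𝒳 ∈ 𝒞, PMM.BoundedlyCompact 𝒳)
    (h : ∀ 𝒳 : ℕ → PMM, (∀ n, 𝒳 n ∈ 𝒞) →
      ∃ (φ : ℕ → ℕ) (𝒴 : PMM), StrictMono φ ∧ 𝒴.BoundedlyCompact ∧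
        Tendsto (fun n => GHP (𝒳 (φ n)) 𝒴) atTop (𝓝 0)) :
    FamSmall 𝒞 := by
  refine famSmall_of_seq fun r ε hr hε X hX => ?_
  obtain ⟨φ, 𝒴, hφ, hY, ht⟩ := h X hX
  obtain ⟨N, hN⟩ := (hY.1 𝒴.basepoint (r + 1)).small (half_pos hε)
  obtain ⟨N', hN'⟩ := exists_nat_ge_ennreal
    (ENNReal.add_ne_top.2 ⟨hY.2 𝒴.basepoint (r + 1), ENNReal.one_ne_top⟩)
  refine ⟨φ, max N N', hφ, ?_⟩
  have ha : 0 < min 1 (min (ε / 2) (1 / (r + 1))) := by positivity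
  filter_upwards [ht.eventually_lt_const ha] with k hk
  obtain ⟨δ, hδ, hδa, Y', hY', hc⟩ := exists_of_GHP_lt hY (min_le_left _ _) hk
  rw [lt_min_iff, lt_min_iff] at hδa
  obtain ⟨hδ1, hδε, hδr⟩ := hδa
  have hrδ : r ≤ 1 / δ := by
    rw [le_div_iff₀ hδ]
    rw [lt_div_iff₀ (by linarith)] at hδr
    linarith
  have hs : NetSmall N (ε / 2) (Metric.closedBall Y'.toPMM.basepoint (r + 2 * (δ / 2))) := by
    obtain ⟨p, hp⟩ := hN
    have hsub : ∀ x ∈ Metric.closedBall Y'.toPMM.basepoint (r + 2 * (δ / 2)),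
        (Subtype.val x : 𝒴.carrier) ∈ Metric.closedBall 𝒴.basepoint (r + 1) := by
      intro x hx
      have hx' : dist (Subtype.val x : 𝒴.carrier) 𝒴.basepoint ≤ r + 2 * (δ / 2) := hx
      rw [Metric.mem_closedBall]
      linarith
    exact ⟨fun x => p (Subtype.val x), fun x hx y hy hxy => hp _ (hsub x hx) _ (hsub y hy) hxy⟩
  have h1 := small_of_cGHP_lt (PMM.ballSub_compact (h𝒞 _ (hX _)) _).isCompactPMM
    hY'.isCompactPMM hc hs
  have h2 := small_transfer hr hrδ h1
  refine ⟨(h2.1.mono le_rfl (le_max_left _ _)).mono_eps (by linarith), h2.2.trans ?_⟩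
  have h3 := Y'.toPMM_meas_preimage hY'.1.measurableSet
    (measurableSet_closedBall (x := 𝒴.basepoint) (ε := r + 2 * (δ / 2)))
  have h4 : Y'.toPMM.meas (Metric.closedBall Y'.toPMM.basepoint (r + 2 * (δ / 2))) = _ := h3
  rw [h4]
  refine le_trans (add_le_add ((Y'.meas_le _).trans
    (measure_mono (Metric.closedBall_subset_closedBall (by linarith)))) ?_) (hN'.trans ?_)
  · rw [ENNReal.ofReal_le_one]; linarith
  · exact_mod_cast le_max_right _ _

/-- **Pre-compactness criterion.** A family `𝒞` of boundedly compact pmm spaces is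
relatively compact under the Gromov-Hausdorff-Prokhorov metric `d` (every sequence in `𝒞`
has a subsequence converging in `d` to a boundedly compact pmm space) if and only if for
every `r ≥ 0` the family of balls `{B̄_r(𝒳) : 𝒳 ∈ 𝒞}` is relatively compact for `dc`
(every sequence in it has a subsequence converging in `dc` to a compact pmm space). -/
theorem GHP_precompactness (𝒞 : Set PMM) (h𝒞 : ∀ 𝒳 ∈ 𝒞, PMM.BoundedlyCompact 𝒳) :
    (∀ 𝒳 : ℕ → PMM, (∀ n, 𝒳 n ∈ 𝒞) →
      ∃ (φ : ℕ → ℕ) (𝒴 : PMM), StrictMono φ ∧ 𝒴.BoundedlyCompact ∧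
        Tendsto (fun n => GHP (𝒳 (φ n)) 𝒴) atTop (𝓝 0)) ↔
    (∀ r : ℝ, 0 ≤ r → ∀ 𝒳 : ℕ → PMM, (∀ n, 𝒳 n ∈ 𝒞) →
      ∃ (φ : ℕ → ℕ) (𝒴 : PMM), StrictMono φ ∧ 𝒴.IsCompactPMM ∧
        Tendsto (fun n => cGHP (((𝒳 (φ n)).ballSub r).toPMM) 𝒴) atTop (𝓝 0)) := by
  constructor
  · intro h r hr X hX
    have hT := famSmall_of_GHP h𝒞 h
    have hS : UnifSmall X := fun r ε hr hε => (hT r ε hr hε).imp fun N hN n => hN _ (hX n)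
    have hb : ∀ n, (X n).BoundedlyCompact := fun n => h𝒞 _ (hX n)
    obtain ⟨L⟩ := exists_ULim X
    obtain ⟨φ, hφ, ht⟩ := UF_extract
      (u := fun n => cGHP ((X n).ballSub r).toPMM (L.limSub hS hr).toPMM)
      (fun n => cGHP_nonneg _ _) (fun ε hε _ => by
        filter_upwards [ULim.app1 (L := L) hS hb hr (show 0 < ε / 5 by linarith)] with n hn
        linarith)
    exact ⟨φ, _, hφ, (ULim.limSub_compact hS hr).isCompactPMM, ht⟩
  · intro h X hX
    have hT := famSmall_of_cGHP h𝒞 h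
    have hS : UnifSmall X := fun r ε hr hε => (hT r ε hr hε).imp fun N hN n => hN _ (hX n)
    have hb : ∀ n, (X n).BoundedlyCompact := fun n => h𝒞 _ (hX n)
    obtain ⟨L⟩ := exists_ULim X
    obtain ⟨φ, hφ, ht⟩ := UF_extract
      (u := fun n => GHP (X n) (L.pmm (unifFin_meas hS)))
      (fun n => GHP_nonneg _ _) (fun ε hε hε1 => L.eventually_GHP_le hS hb hε hε1)
    exact ⟨φ, _, hφ, ULim.pmm_boundedlyCompact hS _, ht⟩

end
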